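/- arXiv:2208.03830 — 3 statements merged into one kernel-verified Lean document; each statement's English description precedes it below -/
import Mathlib

section
/- Let b be a nonzero integer divisible by 5. Then the equation m^5 + 4*b^4*m*n^4 - n^5 = 1 has exactly three solutions in integers (m, n), namely (1, 0), (0, -1) and (1, 4*b^4). -/
namespace QuinticThue

open Polynomial

instance fact_prime_five : Fact (Nat.Prime 5) := ⟨by norm_num⟩

/-- The polynomial `X ^ 5 + c * X - 1`. -/
noncomputable def quinticPoly (A : Type*) [CommRing A] (c : A) : A[X] := X ^ 5 + C c * X - 1

section Poly

variable {A B : Type*} [CommRing A] [CommRing B]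

lemma quinticPoly_eq (c : A) : quinticPoly A c = X ^ 5 + (C c * X - 1) := by
  rw [quinticPoly]; ring

lemma degree_quinticPoly_tail_lt [Nontrivial A] (c : A) :
    (C c * X - 1 : A[X]).degree < (X ^ 5 : A[X]).degree := by
  have : (C c * X - 1 : A[X]).degree ≤ 1 := by compute_degree
  rw [degree_X_pow]
  exact lt_of_le_of_lt this (by norm_num)

lemma monic_quinticPoly [Nontrivial A] (c : A) : (quinticPoly A c).Monic := by
  rw [quinticPoly_eq]
  exact (monic_X_pow 5).add_of_left (degree_quinticPoly_tail_lt c)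

lemma natDegree_quinticPoly [Nontrivial A] (c : A) : (quinticPoly A c).natDegree = 5 := by
  rw [quinticPoly_eq, natDegree_add_eq_left_of_degree_lt (degree_quinticPoly_tail_lt c),
    natDegree_X_pow]

lemma map_quinticPoly (g : A →+* B) (c : A) :
    (quinticPoly A c).map g = quinticPoly B (g c) := by
  simp [quinticPoly]

lemma eval₂_quinticPoly (g : A →+* B) (c : A) (x : B) :
    (quinticPoly A c).eval₂ g x = x ^ 5 + g c * x - 1 := by
  simp [quinticPoly]

lemma root_quinticPoly (c : A) :
    AdjoinRoot.root (quinticPoly A c) ^ 5 +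
      algebraMap A (AdjoinRoot (quinticPoly A c)) c * AdjoinRoot.root (quinticPoly A c) = 1 := by
  have h := AdjoinRoot.eval₂_root (quinticPoly A c)
  rw [eval₂_quinticPoly] at h
  rw [AdjoinRoot.algebraMap_eq]
  linear_combination h

end Poly

lemma irreducible_quinticPoly_int {c : ℤ} (hc : 1 < c) :
    Irreducible (quinticPoly ℤ c) := by
  have hm := monic_quinticPoly c
  have hne : quinticPoly ℤ c ≠ 1 := fun h => by
    have := natDegree_quinticPoly c
    rw [h] at this
    simp at this
  rw [hm.irreducible_iff_lt_natDegree_lt hne, natDegree_quinticPoly]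
  rintro q hq hdeg ⟨p, hp⟩
  have hpm : p.Monic := by
    rw [hp] at hm
    exact hq.of_mul_monic_left hm
  have hd := congrArg natDegree hp
  rw [natDegree_quinticPoly, hq.natDegree_mul hpm] at hd
  have hcoeff : ∀ i, (quinticPoly ℤ c).coeff i = (q * p).coeff i := fun i => by rw [hp]
  have h0 := hcoeff 0
  have h1 := hcoeff 1
  have h2 := hcoeff 2
  have h3 := hcoeff 3
  have h4 := hcoeff 4
  simp only [quinticPoly, coeff_sub, coeff_add, coeff_C_mul, coeff_mul (p := q),
    Finset.Nat.antidiagonal_succ] at h0 h1 h2 h3 h4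
  simp [coeff_X, coeff_one] at h0 h1 h2 h3 h4
  have hql := hq.coeff_natDegree
  have hpl := hpm.coeff_natDegree
  have hq0 : ∀ i, q.natDegree < i → q.coeff i = 0 := fun i => coeff_eq_zero_of_natDegree_lt
  have hp0 : ∀ i, p.natDegree < i → p.coeff i = 0 := fun i => coeff_eq_zero_of_natDegree_lt
  rw [Finset.mem_Ioc] at hdeg
  obtain ⟨hl, hu⟩ := hdeg
  obtain h | h : q.natDegree = 1 ∨ q.natDegree = 2 := by omega
  · obtain h' : p.natDegree = 4 := by omega
    rw [h] at hql hq0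
    rw [h'] at hpl hp0
    simp only [hql, hpl, hq0 2 (by norm_num), hq0 3 (by norm_num), hq0 4 (by norm_num)]
      at h1 h2 h3 h4
    obtain h5 | h5 : q.coeff 0 = 1 ∨ q.coeff 0 = -1 :=
      Int.isUnit_iff.1 (IsUnit.of_mul_eq_one (-p.coeff 0) (by linarith))
    all_goals
      simp only [h5] at h0 h1 h2 h3 h4
      linarith
  · obtain h' : p.natDegree = 3 := by omega
    rw [h] at hql hq0
    rw [h'] at hpl hp0
    simp only [hql, hpl, hq0 3 (by norm_num), hq0 4 (by norm_num), hp0 4 (by norm_num)]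
      at h1 h2 h3 h4
    have hs : p.coeff 2 = -q.coeff 1 := by linarith
    have ht : p.coeff 1 = q.coeff 1 ^ 2 - q.coeff 0 := by rw [hs] at h3; linarith
    rw [hs, ht] at h2
    obtain h5 | h5 : q.coeff 0 = 1 ∨ q.coeff 0 = -1 :=
      Int.isUnit_iff.1 (IsUnit.of_mul_eq_one (-p.coeff 0) (by linarith))
    all_goals
      rw [ht] at h1
      simp only [h5] at h0 h1 h2
      have hp0' : p.coeff 0 = 1 ∨ p.coeff 0 = -1 := by omega
      have hd : q.coeff 1 ∣ 1 := by
        rcases hp0' with h6 | h6 <;> rw [h6] at h2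
        all_goals first
          | exact ⟨q.coeff 1 ^ 2 - 2, by linarith⟩
          | exact ⟨-(q.coeff 1 ^ 2 - 2), by linarith⟩
          | exact ⟨q.coeff 1 ^ 2 + 2, by linarith⟩
          | exact ⟨-(q.coeff 1 ^ 2 + 2), by linarith⟩
      obtain h7 | h7 := Int.isUnit_iff.1 (isUnit_of_dvd_one hd)
      all_goals
        rw [h7] at h1 h2
        linarith

section Expansion

lemma dvd_choose_mul_pow {q : ℤ_[5]} (hq : (5 : ℤ_[5]) ∣ q) (k j : ℕ) (hj : 4 ≤ j) :
    5 * (k : ℤ_[5]) * q ^ 3 ∣ (k.choose j : ℤ_[5]) * q ^ j := by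
  obtain ⟨i, rfl⟩ : ∃ i, j = i + 1 := ⟨j - 1, by omega⟩
  rcases k with _ | k
  · simp
  obtain ⟨a, j', hj', hja⟩ := Nat.exists_eq_pow_mul_and_not_dvd (n := i + 1) (by omega) 5 (by norm_num)
  have hunit : IsUnit (j' : ℤ_[5]) := by
    rw [PadicInt.isUnit_iff]
    exact PadicInt.norm_natCast_eq_one_iff.2 ((Nat.Prime.coprime_iff_not_dvd (by norm_num)).2 hj')
  have ha : a + 3 ≤ i := by
    rcases Nat.lt_or_ge a 2 with h | h
    · interval_cases a
      · omega
      · have : j' ≠ 0 := by rintro rfl; simp at hj'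
        omega
    · have h1 : j' ≠ 0 := by rintro rfl; simp at hj'
      have h2 : 5 ^ a ≤ i + 1 := by rw [hja]; exact Nat.le_mul_of_pos_right _ (by omega)
      have h3 : ∀ a, 2 ≤ a → a + 4 ≤ 5 ^ a := by
        intro a ha
        induction a, ha using Nat.le_induction with
        | base => norm_num
        | succ n hn ih => rw [pow_succ]; omega
      have := h3 a h
      omega
  obtain ⟨w, hw⟩ : (5 : ℤ_[5]) ^ (a + 1) ∣ q ^ (i - 2) :=
    (pow_dvd_pow 5 (by omega)).trans (pow_dvd_pow_of_dvd hq _)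
  have hqi : q ^ (i + 1) = q ^ 3 * q ^ (i - 2) := by rw [← pow_add]; congr 1; omega
  have hch : ((k + 1 : ℕ) : ℤ_[5]) * (k.choose i : ℤ_[5]) =
      ((k + 1).choose (i + 1) : ℤ_[5]) * (5 ^ a * j') := by
    have := Nat.add_one_mul_choose_eq k i
    have h2 : (k + 1) * k.choose i = (k + 1).choose (i + 1) * (5 ^ a * j') := by rw [← hja, this]
    exact_mod_cast h2
  obtain ⟨u, hu⟩ := hunit
  rw [← hu] at hch
  refine ⟨(k.choose i : ℤ_[5]) * w * (u⁻¹ : ℤ_[5]ˣ), ?_⟩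
  have h1 : (u : ℤ_[5]) * (u⁻¹ : ℤ_[5]ˣ) = 1 := u.mul_inv
  rw [hqi, hw]
  linear_combination -5 * w * q ^ 3 * (u⁻¹ : ℤ_[5]ˣ) * hch -
    ((k + 1).choose (i + 1) : ℤ_[5]) * q ^ 3 * 5 ^ (a + 1) * w * h1

end Expansion

section Expansion

variable {S : Type*} [CommRing S] [Algebra ℤ_[5] S]

lemma exists_intCast_mul_eq_one {a : ℤ} (ha : ¬ 5 ∣ a) : ∃ i : S, a * i = 1 := by
  have hunit : IsUnit (a : ℤ_[5]) := by
    by_contra h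
    rw [PadicInt.not_isUnit_iff, PadicInt.norm_int_lt_one_iff_dvd] at h
    exact ha (by exact_mod_cast h)
  obtain ⟨u, hu⟩ := hunit.map (algebraMap ℤ_[5] S)
  refine ⟨(u⁻¹ : Sˣ), ?_⟩
  have := u.mul_inv
  rwa [hu, map_intCast] at this

lemma exists_six_mul_eq_one : ∃ h : S, 6 * h = 1 := by
  obtain ⟨i, hi⟩ := exists_intCast_mul_eq_one (S := S) (a := 6) (by norm_num)
  exact ⟨i, by simpa using hi⟩

lemma intCast_dvd_or_five_mul_dvd (a b : ℤ) :
    ((b : ℤ_[5]) ∣ a) ∨ (5 * a : ℤ_[5]) ∣ b := by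
  by_cases h : (b : ℤ_[5]) ∣ a
  · exact .inl h
  · right
    obtain ⟨s, hs⟩ := (ValuationRing.dvd_total (b : ℤ_[5]) a).resolve_left h
    have hs' : ¬ IsUnit s := by
      rintro ⟨u, rfl⟩
      exact h ⟨(u⁻¹ : ℤ_[5]ˣ), by rw [hs, mul_assoc, u.mul_inv, mul_one]⟩
    rw [PadicInt.not_isUnit_iff, PadicInt.norm_lt_one_iff_dvd] at hs'
    rw [hs, mul_comm 5]
    exact mul_dvd_mul_left _ (by exact_mod_cast hs')

lemma cast_choose_two_mul_two (R : Type*) [CommRing R] (k : ℕ) :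
    (k.choose 2 : R) * 2 = k * (k - 1) := by
  induction k with
  | zero => simp
  | succ k ih =>
    rw [Nat.choose_succ_succ' k 1, Nat.choose_one_right]
    push_cast
    linear_combination ih

lemma cast_choose_three_mul_six (R : Type*) [CommRing R] (k : ℕ) :
    (k.choose 3 : R) * 6 = k * (k - 1) * (k - 2) := by
  induction k with
  | zero => simp
  | succ k ih =>
    rw [Nat.choose_succ_succ' k 2]
    push_cast
    linear_combination ih + 3 * cast_choose_two_mul_two R k

lemma one_add_pow_expansion {h : S} (h6 : 6 * h = 1) {q : ℤ} (hq : 5 ∣ q) (y : S) (k : ℕ) :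
    ∃ r : S, (1 + q * y) ^ k = 1 + k * q * y + 3 * h * k * (k - 1) * q ^ 2 * y ^ 2 +
      h * k * (k - 1) * (k - 2) * q ^ 3 * y ^ 3 + 5 * k * q ^ 3 * r := by
  have hterm : ∀ j, ∃ r : S, ((k.choose (j + 4) : ℕ) : S) * q ^ (j + 4) = 5 * k * q ^ 3 * r := by
    intro j
    obtain ⟨q', hq'⟩ := hq
    obtain ⟨r, hr⟩ := dvd_choose_mul_pow (q := (q : ℤ_[5]))
      ⟨(q' : ℤ_[5]), by rw [hq']; push_cast; ring⟩ k (j + 4) (by omega)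
    refine ⟨algebraMap ℤ_[5] S r, ?_⟩
    simpa [map_ofNat] using congrArg (algebraMap ℤ_[5] S) hr
  choose r hr using hterm
  refine ⟨∑ j ∈ Finset.range k, r j * y ^ (j + 4), ?_⟩
  have hsum : (1 + (q : S) * y) ^ k =
      ∑ j ∈ Finset.range (k + 4), (k.choose j : S) * q ^ j * y ^ j := by
    rw [add_comm, add_pow, eq_comm, ← Finset.sum_subset (s₁ := Finset.range (k + 1))]
    · exact Finset.sum_congr rfl fun j _ => by rw [mul_pow]; ring
    · intro j; simp only [Finset.mem_range]; omega
    · intro j _ hj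
      rw [Nat.choose_eq_zero_of_lt (by simpa using hj)]
      simp
  rw [hsum, Finset.sum_range_succ', Finset.sum_range_succ', Finset.sum_range_succ',
    Finset.sum_range_succ', Finset.mul_sum]
  have h2 := cast_choose_two_mul_two S k
  have h3 := cast_choose_three_mul_six S k
  have hs : ∀ j ∈ Finset.range k, (k.choose (j + 1 + 1 + 1 + 1) : S) * q ^ (j + 1 + 1 + 1 + 1) *
      y ^ (j + 1 + 1 + 1 + 1) = 5 * k * q ^ 3 * (r j * y ^ (j + 4)) := by
    intro j _
    rw [hr j]; ring
  rw [Finset.sum_congr rfl hs]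
  simp only [zero_add, Nat.choose_zero_right, Nat.choose_one_right, Nat.reduceAdd]
  push_cast
  linear_combination (3 * h * q ^ 2 * y ^ 2) * h2 + h * q ^ 3 * y ^ 3 * h3 -
    ((k.choose 2 : S) * q ^ 2 * y ^ 2 + (k.choose 3 : S) * q ^ 3 * y ^ 3) * h6

lemma one_add_zpow_expansion {h : S} (h6 : 6 * h = 1) {q : ℤ} (hq : 5 ∣ q) {y : S} {x : Sˣ}
    (hx : (x : S) = 1 + q * y) (k : ℤ) :
    ∃ r : S, ((x ^ k : Sˣ) : S) = 1 + k * q * y + 3 * h * k * (k - 1) * q ^ 2 * y ^ 2 +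
      h * k * (k - 1) * (k - 2) * q ^ 3 * y ^ 3 + 5 * k * q ^ 3 * r := by
  obtain ⟨k, rfl | rfl⟩ := k.eq_nat_or_neg
  · obtain ⟨r, hr⟩ := one_add_pow_expansion h6 hq y k
    exact ⟨r, by simpa [hx] using hr⟩
  · obtain ⟨r, hr⟩ := one_add_pow_expansion h6 hq y k
    obtain ⟨q', rfl⟩ := hq
    have hinv : ((x ^ (-(k : ℤ)) : Sˣ) : S) * (1 + (5 * q' : ℤ) * y) ^ k = 1 := by
      rw [← hx, ← Units.val_pow_eq_pow_val, ← Units.val_mul]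
      simp
    generalize ((x ^ (-(k : ℤ)) : Sˣ) : S) = w at *
    rw [hr] at hinv
    push_cast at hinv ⊢
    refine ⟨w * r * (1 - k * (5 * q' * y) + 3 * h * k * (k + 1) * (5 * q' * y) ^ 2 -
      h * k * (k + 1) * (k + 2) * (5 * q' * y) ^ 3) + w * k * q' * y ^ 4 *
      ((9 * h ^ 2 * (k ^ 2 - 1) - h * (2 * k ^ 2 + 4)) -
      12 * h ^ 2 * (k ^ 2 - 1) * (5 * q' * y) -
      h ^ 2 * (k ^ 2 - 1) * (k ^ 2 - 4) * (5 * q' * y) ^ 2), ?_⟩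
    linear_combination (1 - k * (5 * q' * y) + 3 * h * k * (k + 1) * (5 * q' * y) ^ 2 -
      h * k * (k + 1) * (k + 2) * (5 * q' * y) ^ 3) * hinv -
      w * k ^ 2 * (5 * q' * y) ^ 2 * h6

lemma one_add_zpow {q : ℤ} (hq : 5 ∣ q) {y : S} {x : Sˣ} (hx : (x : S) = 1 + q * y) (k : ℤ) :
    ∃ r : S, ((x ^ k : Sˣ) : S) = 1 + k * q * (y + 5 * r) := by
  obtain ⟨h, h6⟩ := exists_six_mul_eq_one (S := S)
  obtain ⟨r, hr⟩ := one_add_zpow_expansion h6 hq hx k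
  obtain ⟨q', rfl⟩ := hq
  refine ⟨3 * h * (k - 1) * q' * y ^ 2 + 5 * h * (k - 1) * (k - 2) * q' ^ 2 * y ^ 3 +
    25 * q' ^ 2 * r, ?_⟩
  rw [hr]
  push_cast
  ring

lemma eq_zero_of_zpow_mul_eq_one (h5 : ∀ s : S, 5 * s = 0 → s = 0) {q₁ q₂ q₃ : ℤ}
    (hq₁ : 5 ∣ q₁) (hq₂ : 5 ∣ q₂) (hq₃ : 5 ∣ q₃) (hq₁' : q₁ ≠ 0) (hq₂' : q₂ ≠ 0) (hq₃' : q₃ ≠ 0)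
    {x₁ x₂ x₃ : Sˣ} {y₁ y₂ y₃ : S} (hx₁ : (x₁ : S) = 1 + q₁ * y₁) (hx₂ : (x₂ : S) = 1 + q₂ * y₂)
    (hx₃ : (x₃ : S) = 1 + q₃ * y₃)
    (hind : ∀ a₁ a₂ a₃ : ℤ, (5 : S) ∣ a₁ * y₁ + a₂ * y₂ + a₃ * y₃ → 5 ∣ a₁ ∧ 5 ∣ a₂ ∧ 5 ∣ a₃)
    {k₁ k₂ k₃ : ℤ} (hk : x₁ ^ k₁ * x₂ ^ k₂ * x₃ ^ k₃ = 1) : k₁ = 0 ∧ k₂ = 0 ∧ k₃ = 0 := by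
  obtain ⟨r₁, hr₁⟩ := one_add_zpow hq₁ hx₁ k₁
  obtain ⟨r₂, hr₂⟩ := one_add_zpow hq₂ hx₂ k₂
  obtain ⟨r₃, hr₃⟩ := one_add_zpow hq₃ hx₃ k₃
  have hprod : (1 + k₁ * q₁ * (y₁ + 5 * r₁)) * (1 + k₂ * q₂ * (y₂ + 5 * r₂)) *
      (1 + k₃ * q₃ * (y₃ + 5 * r₃)) = 1 := by
    rw [← hr₁, ← hr₂, ← hr₃, ← Units.val_mul, ← Units.val_mul, hk, Units.val_one]
  have h5pow : ∀ (e : ℕ) (s : S), 5 ^ e * s = 0 → s = 0 := by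
    intro e
    induction e with
    | zero => simp
    | succ e ih => exact fun s hs => h5 s (ih _ (by rw [← hs]; ring))
  have key : ∀ e : ℕ, 5 ^ (e + 1) ∣ k₁ * q₁ ∧ 5 ^ (e + 1) ∣ k₂ * q₂ ∧ 5 ^ (e + 1) ∣ k₃ * q₃ := by
    intro e
    induction e with
    | zero => simpa using ⟨hq₁.mul_left _, hq₂.mul_left _, hq₃.mul_left _⟩
    | succ e ih =>
      obtain ⟨⟨a₁, h₁⟩, ⟨a₂, h₂⟩, ⟨a₃, h₃⟩⟩ := ih
      have h₁' : (k₁ : S) * q₁ = 5 ^ (e + 1) * a₁ := by exact_mod_cast congrArg Int.cast h₁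
      have h₂' : (k₂ : S) * q₂ = 5 ^ (e + 1) * a₂ := by
        exact_mod_cast congrArg (Int.cast (R := S)) h₂
      have h₃' : (k₃ : S) * q₃ = 5 ^ (e + 1) * a₃ := by
        exact_mod_cast congrArg (Int.cast (R := S)) h₃
      rw [h₁', h₂', h₃'] at hprod
      have hd := hind a₁ a₂ a₃ ⟨-(a₁ * r₁ + a₂ * r₂ + a₃ * r₃ + 5 ^ e * (
        a₁ * (y₁ + 5 * r₁) * (a₂ * (y₂ + 5 * r₂)) + a₁ * (y₁ + 5 * r₁) * (a₃ * (y₃ + 5 * r₃)) +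
        a₂ * (y₂ + 5 * r₂) * (a₃ * (y₃ + 5 * r₃)) + 5 ^ (e + 1) * (a₁ * (y₁ + 5 * r₁) *
        (a₂ * (y₂ + 5 * r₂)) * (a₃ * (y₃ + 5 * r₃))))), by
          rw [← sub_eq_zero]
          apply h5pow (e + 1)
          linear_combination hprod⟩
      rw [h₁, h₂, h₃, pow_succ 5 (e + 1)]
      exact ⟨mul_dvd_mul_left _ hd.1, mul_dvd_mul_left _ hd.2.1, mul_dvd_mul_left _ hd.2.2⟩
  have hzero : ∀ a : ℤ, (∀ e : ℕ, 5 ^ (e + 1) ∣ a) → a = 0 := by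
    intro a ha
    by_contra hne
    have h1 := Int.natAbs_dvd_natAbs.2 (ha a.natAbs)
    have h2 := Nat.le_of_dvd (Int.natAbs_pos.2 hne) h1
    rw [Int.natAbs_pow] at h2
    have h3 : a.natAbs < 5 ^ a.natAbs := Nat.lt_pow_self (by norm_num)
    have h4 : 5 ^ a.natAbs ≤ 5 ^ (a.natAbs + 1) := Nat.pow_le_pow_right (by norm_num) (by omega)
    exact absurd h2 (by simpa using lt_of_lt_of_le h3 h4)
  exact ⟨(mul_eq_zero.1 (hzero _ fun e => (key e).1)).resolve_right hq₁',
    (mul_eq_zero.1 (hzero _ fun e => (key e).2.1)).resolve_right hq₂',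
    (mul_eq_zero.1 (hzero _ fun e => (key e).2.2)).resolve_right hq₃'⟩

end Expansion

section UnitRank

open NumberField

lemma irreducible_quinticPoly_rat {c : ℤ} (hc : 1 < c) : Irreducible (quinticPoly ℚ (c : ℚ)) := by
  have h := (monic_quinticPoly c).irreducible_iff_irreducible_map_fraction_map (K := ℚ)
  rw [map_quinticPoly] at h
  simpa using h.1 (irreducible_quinticPoly_int hc)

section PowerBasis

variable {K : Type*} [Field K] [NumberField K] (pb : PowerBasis ℚ K) {c : ℤ}

lemma gen_quinticPoly (hpb : minpoly ℚ pb.gen = quinticPoly ℚ (c : ℚ)) :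
    pb.gen ^ 5 + c * pb.gen = 1 := by
  have h := minpoly.aeval ℚ pb.gen
  rw [hpb, aeval_def, eval₂_quinticPoly] at h
  simpa [sub_eq_zero] using h

/-- Since `x ^ 5 + c * x` is strictly increasing for `0 < c`, a number field generated by a root
of `X ^ 5 + c * X - 1` has at most one real place. -/
lemma nrRealPlaces_le_one_of_quinticPoly (hc : 0 < c)
    (hpb : minpoly ℚ pb.gen = quinticPoly ℚ (c : ℚ)) :
    InfinitePlace.nrRealPlaces K ≤ 1 := by
  classical
  rw [InfinitePlace.nrRealPlaces, Fintype.card_le_one_iff_subsingleton]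
  suffices Subsingleton { φ : K →+* ℂ // ComplexEmbedding.IsReal φ } from
    InfinitePlace.mkReal.symm.subsingleton
  have hroot : ∀ φ : K →+* ℂ, ComplexEmbedding.IsReal φ →
      ∃ x : ℝ, φ pb.gen = x ∧ x ^ 5 + c * x = 1 := by
    intro φ hφ
    refine ⟨hφ.embedding pb.gen, (hφ.coe_embedding_apply _).symm, ?_⟩
    simpa using congrArg hφ.embedding (gen_quinticPoly pb hpb)
  constructor
  rintro ⟨φ, hφ⟩ ⟨φ', hφ'⟩
  obtain ⟨x, hx, hx1⟩ := hroot φ hφ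
  obtain ⟨y, hy, hy1⟩ := hroot φ' hφ'
  have hmono : StrictMono fun t : ℝ => t ^ 5 + c * t := by
    have h5 : StrictMono fun t : ℝ => t ^ 5 := Odd.strictMono_pow (by decide)
    exact h5.add (strictMono_mul_left_of_pos (by exact_mod_cast hc))
  have hxy : x = y := hmono.injective (by simpa using hx1.trans hy1.symm)
  have hext : φ.toRatAlgHom = φ'.toRatAlgHom := pb.algHom_ext (by simp [hx, hy, hxy])
  rw [Subtype.mk.injEq]
  ext z
  exact DFunLike.congr_fun hext z

lemma units_rank_le_two_of_quinticPoly (hc : 0 < c)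
    (hpb : minpoly ℚ pb.gen = quinticPoly ℚ (c : ℚ)) : Units.rank K ≤ 2 := by
  have h1 := nrRealPlaces_le_one_of_quinticPoly pb hc hpb
  have h2 := InfinitePlace.card_add_two_mul_card_eq_rank K
  have h3 := InfinitePlace.card_eq_nrRealPlaces_add_nrComplexPlaces K
  rw [pb.finrank, ← pb.natDegree_minpoly, hpb, natDegree_quinticPoly] at h2
  rw [Units.rank]
  omega

lemma exists_injective_ringOfIntegers (hpb : minpoly ℚ pb.gen = quinticPoly ℚ (c : ℚ)) :
    ∃ ψ : AdjoinRoot (quinticPoly ℤ c) →+* 𝓞 K, Function.Injective ψ := by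
  have hθ := gen_quinticPoly pb hpb
  have hint : IsIntegral ℤ pb.gen := by
    refine ⟨quinticPoly ℤ c, monic_quinticPoly c, ?_⟩
    rw [eval₂_quinticPoly]
    simpa [sub_eq_zero] using hθ
  obtain ⟨θ, hθK⟩ : ∃ θ : 𝓞 K, algebraMap (𝓞 K) K θ = pb.gen := ⟨⟨pb.gen, hint⟩, rfl⟩
  have hθ' : (quinticPoly ℤ c).eval₂ (algebraMap ℤ (𝓞 K)) θ = 0 := by
    rw [eval₂_quinticPoly]
    apply RingOfIntegers.ext
    simpa [hθK, sub_eq_zero] using hθ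
  refine ⟨AdjoinRoot.lift (algebraMap ℤ (𝓞 K)) θ hθ', ?_⟩
  rw [injective_iff_map_eq_zero]
  intro s hs
  induction s using AdjoinRoot.induction_on with
  | ih p =>
    rw [AdjoinRoot.lift_mk] at hs
    have h1 : aeval pb.gen (p.map (Int.castRingHom ℚ)) = 0 := by
      have h2 := congrArg (algebraMap (𝓞 K) K) hs
      rw [Polynomial.hom_eval₂, map_zero, hθK] at h2
      rw [aeval_def, eval₂_map, ← h2]
      congr 1
      exact Subsingleton.elim _ _
    have h3 : quinticPoly ℚ (c : ℚ) = (quinticPoly ℤ c).map (Int.castRingHom ℚ) := by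
      simp [map_quinticPoly]
    have h4 := minpoly.dvd ℚ pb.gen h1
    rw [hpb, h3] at h4
    rw [AdjoinRoot.mk_eq_zero]
    exact (Polynomial.map_dvd_map _ (RingHom.injective_int _) (monic_quinticPoly c)).1 h4

lemma exists_zpow_mul_eq_one_of_powerBasis (hc : 0 < c)
    (hpb : minpoly ℚ pb.gen = quinticPoly ℚ (c : ℚ))
    (x₁ x₂ x₃ : (AdjoinRoot (quinticPoly ℤ c))ˣ) :
    ∃ k₁ k₂ k₃ : ℤ, ¬(k₁ = 0 ∧ k₂ = 0 ∧ k₃ = 0) ∧ x₁ ^ k₁ * x₂ ^ k₂ * x₃ ^ k₃ = 1 := by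
  obtain ⟨ψ, hψ⟩ := exists_injective_ringOfIntegers pb hpb
  let v : Fin 3 → Additive (𝓞 K)ˣ := fun i =>
    Additive.ofMul (Units.map (ψ : _ →* 𝓞 K) (![x₁, x₂, x₃] i))
  have hdep : ¬ LinearIndependent ℤ v := by
    intro h
    have h1 := h.fintype_card_le_finrank
    have h2 := units_rank_le_two_of_quinticPoly pb hc hpb
    rw [Units.finrank_eq, Fintype.card_fin] at h1
    omega
  obtain ⟨g, hg, i, hi⟩ := Fintype.not_linearIndependent_iff.1 hdep
  refine ⟨g 0, g 1, g 2, ?_, ?_⟩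
  · rintro ⟨h0, h1, h2⟩
    fin_cases i
    exacts [hi h0, hi h1, hi h2]
  · apply Units.map_injective (f := (ψ : _ →* 𝓞 K)) hψ
    rw [Fin.sum_univ_three] at hg
    have := congrArg Additive.toMul hg
    simpa [v] using this

end PowerBasis

lemma exists_zpow_mul_eq_one {c : ℤ} (hc : 1 < c) (x₁ x₂ x₃ : (AdjoinRoot (quinticPoly ℤ c))ˣ) :
    ∃ k₁ k₂ k₃ : ℤ, ¬(k₁ = 0 ∧ k₂ = 0 ∧ k₃ = 0) ∧ x₁ ^ k₁ * x₂ ^ k₂ * x₃ ^ k₃ = 1 := by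
  have hirr := irreducible_quinticPoly_rat hc
  have : Fact (Irreducible (quinticPoly ℚ (c : ℚ))) := ⟨hirr⟩
  let pb := AdjoinRoot.powerBasis hirr.ne_zero
  have : FiniteDimensional ℚ (AdjoinRoot (quinticPoly ℚ (c : ℚ))) := pb.finite
  have : CharZero (AdjoinRoot (quinticPoly ℚ (c : ℚ))) := algebraRat.charZero _
  have : NumberField (AdjoinRoot (quinticPoly ℚ (c : ℚ))) := ⟨⟩
  have hpb : minpoly ℚ pb.gen = quinticPoly ℚ (c : ℚ) := by
    exact AdjoinRoot.minpoly_powerBasis_gen_of_monic (monic_quinticPoly _)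
  exact exists_zpow_mul_eq_one_of_powerBasis pb (by omega) hpb x₁ x₂ x₃

end UnitRank

section LocalRing

lemma five_dvd_of_five_dvd_quinticPoly {c : ℤ_[5]} {a₀ a₁ a₂ a₃ a₄ : ℤ_[5]}
    (h : (5 : AdjoinRoot (quinticPoly ℤ_[5] c)) ∣
      AdjoinRoot.mk (quinticPoly ℤ_[5] c)
        (C a₄ * X ^ 4 + C a₃ * X ^ 3 + C a₂ * X ^ 2 + C a₁ * X + C a₀)) :
    5 ∣ a₁ ∧ 5 ∣ a₂ ∧ 5 ∣ a₃ ∧ 5 ∣ a₄ := by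
  obtain ⟨s, hs⟩ := h
  obtain ⟨p, rfl⟩ := AdjoinRoot.mk_surjective s
  have h5 : (5 : AdjoinRoot (quinticPoly ℤ_[5] c)) = AdjoinRoot.mk (quinticPoly ℤ_[5] c) 5 := by
    rw [map_ofNat]
  rw [h5, ← map_mul, AdjoinRoot.mk_eq_mk] at hs
  have hd := Polynomial.map_dvd (PadicInt.toZMod (p := 5)) hs
  rw [map_quinticPoly, Polynomial.map_sub, Polynomial.map_mul, Polynomial.map_ofNat] at hd
  have h50 : (5 : (ZMod 5)[X]) = 0 := by
    have : ((5 : ℕ) : (ZMod 5)[X]) = 0 := CharP.cast_eq_zero _ 5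
    simpa using this
  rw [h50, zero_mul, sub_zero] at hd
  have hz := Polynomial.eq_zero_of_dvd_of_natDegree_lt hd (by
    rw [natDegree_quinticPoly]
    simp only [Polynomial.map_add, Polynomial.map_mul, Polynomial.map_C, Polynomial.map_pow,
      Polynomial.map_X]
    refine lt_of_le_of_lt (b := 4) ?_ (by norm_num)
    compute_degree)
  have hcoeff : ∀ i, (C a₄ * X ^ 4 + C a₃ * X ^ 3 + C a₂ * X ^ 2 + C a₁ * X + C a₀).coeff i ∈
      RingHom.ker (PadicInt.toZMod (p := 5)) := by
    intro i
    rw [RingHom.mem_ker, ← Polynomial.coeff_map, hz, Polynomial.coeff_zero]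
  rw [PadicInt.ker_toZMod, PadicInt.maximalIdeal_eq_span_p] at hcoeff
  have h1 := hcoeff 1
  have h2 := hcoeff 2
  have h3 := hcoeff 3
  have h4 := hcoeff 4
  rw [Ideal.mem_span_singleton] at h1 h2 h3 h4
  simp [coeff_C] at h1 h2 h3 h4
  exact ⟨h1, h2, h3, h4⟩

lemma five_mul_eq_zero {c : ℤ_[5]} (s : AdjoinRoot (quinticPoly ℤ_[5] c)) (h : 5 * s = 0) :
    s = 0 := by
  have pb := AdjoinRoot.powerBasis' (monic_quinticPoly c)
  have h' : (5 : ℤ_[5]) • s = 0 := by rw [Algebra.smul_def, map_ofNat, h]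
  have : Module.Free ℤ_[5] (AdjoinRoot (quinticPoly ℤ_[5] c)) := Module.Free.of_basis pb.basis
  exact (smul_eq_zero.1 h').resolve_left (by norm_num)

end LocalRing

section Units

variable {A : Type*} [CommRing A] {θ : A}

lemma root_mul_inv {c : A} (hθ : θ ^ 5 + c * θ = 1) : θ * (θ ^ 4 + c) = 1 := by
  linear_combination hθ

/-- A root of `X ^ 5 + c * X - 1` as a unit. -/
def rootUnit {c : A} (hθ : θ ^ 5 + c * θ = 1) : Aˣ :=
  ⟨θ, θ ^ 4 + c, root_mul_inv hθ, (mul_comm _ _).trans (root_mul_inv hθ)⟩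

lemma isUnit_one_add_inv_root {b : A} (hθ : θ ^ 5 + 4 * b ^ 4 * θ = 1) :
    IsUnit (1 + b * (2 * (θ ^ 4 + 4 * b ^ 4) + 2 * b * (θ ^ 4 + 4 * b ^ 4) ^ 2)) := by
  refine IsUnit.of_mul_eq_one (θ ^ 5 *
    (1 - 2 * b * (θ ^ 4 + 4 * b ^ 4) + 2 * b ^ 2 * (θ ^ 4 + 4 * b ^ 4) ^ 2)) ?_
  have h := root_mul_inv hθ
  set φ := θ ^ 4 + 4 * b ^ 4
  have h4 : (θ * φ) ^ 4 = 1 := by rw [h, one_pow]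
  linear_combination hθ + 4 * b ^ 4 * θ * h4

lemma isUnit_sub_mul_root {c m n : A} (hθ : θ ^ 5 + c * θ = 1)
    (hmn : m ^ 5 + c * m * n ^ 4 - n ^ 5 = 1) : IsUnit (m - n * θ) := by
  refine IsUnit.of_mul_eq_one (m ^ 4 + m ^ 3 * (n * θ) + m ^ 2 * (n * θ) ^ 2 + m * (n * θ) ^ 3 +
    (n * θ) ^ 4 + c * n ^ 4) ?_
  linear_combination hmn - n ^ 5 * hθ

end Units

section Transverse

variable {S : Type*} [CommRing S] [Algebra ℤ_[5] S]

/-- `x` has the form `1 + q * y`, where `q ≠ 0` is a multiple of `5` and `y` is congruent modulo `5`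
to a combination of `θ, θ ^ 2, θ ^ 3, θ ^ 4` in which `θ ^ 2` or `θ ^ 3` has a unit coefficient. -/
def IsTransverse (θ x : S) : Prop :=
  ∃ q : ℤ, 5 ∣ q ∧ q ≠ 0 ∧ ∃ (a₁ a₂ a₃ a₄ : ℤ_[5]) (r : S),
    x = 1 + q * (algebraMap ℤ_[5] S a₁ * θ + algebraMap ℤ_[5] S a₂ * θ ^ 2 +
      algebraMap ℤ_[5] S a₃ * θ ^ 3 + algebraMap ℤ_[5] S a₄ * θ ^ 4 + 5 * r) ∧
    (¬ 5 ∣ a₂ ∨ ¬ 5 ∣ a₃)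

lemma five_dvd_intCast_iff {a : ℤ} : (5 : ℤ_[5]) ∣ a ↔ 5 ∣ a := by
  rw [← Nat.cast_ofNat (R := ℤ), ← PadicInt.norm_int_lt_one_iff_dvd, PadicInt.norm_lt_one_iff_dvd]
  norm_num

lemma prime_five_padicInt : Prime (5 : ℤ_[5]) := by
  exact_mod_cast PadicInt.prime_p (p := 5)

end Transverse

lemma not_isTransverse {b : ℤ} (hb : b ≠ 0) (hb5 : 5 ∣ b)
    (ψ : AdjoinRoot (quinticPoly ℤ (4 * b ^ 4)) →+*
      AdjoinRoot (quinticPoly ℤ_[5] ((4 * b ^ 4 : ℤ) : ℤ_[5])))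
    (hψ : ψ (AdjoinRoot.root _) = AdjoinRoot.root _)
    (x : (AdjoinRoot (quinticPoly ℤ (4 * b ^ 4)))ˣ) :
    ¬ IsTransverse (AdjoinRoot.root _) (ψ x) := by
  rintro ⟨q, hq, hq', a₁, a₂, a₃, a₄, r, hx, ha⟩
  have hb4 : 0 < b ^ 4 := by positivity
  have hθ := root_quinticPoly (4 * b ^ 4)
  rw [eq_intCast] at hθ
  push_cast at hθ
  obtain ⟨w, hw⟩ := isUnit_one_add_inv_root hθ
  obtain ⟨k₁, k₂, k₃, hk, hrel⟩ :=
    exists_zpow_mul_eq_one (c := 4 * b ^ 4) (by omega) x (rootUnit hθ ^ 5) w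
  refine hk ?_
  have hrel' := congrArg (Units.map ψ.toMonoidHom) hrel
  simp only [map_mul, map_zpow, map_one] at hrel'
  set θ := AdjoinRoot.root (quinticPoly ℤ_[5] ((4 * b ^ 4 : ℤ) : ℤ_[5])) with hroot
  refine eq_zero_of_zpow_mul_eq_one five_mul_eq_zero hq (q₂ := 4 * b ^ 4) ?_ hb5 hq'
    (by positivity) hb hx (y₂ := -θ) ?_
    (y₃ := 2 * (θ ^ 4 + 4 * b ^ 4) + 2 * b * (θ ^ 4 + 4 * b ^ 4) ^ 2) ?_ ?_ hrel'
  · exact (hb5.trans (dvd_pow_self b (by norm_num))).mul_left 4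
  · have := congrArg ψ hθ
    simp only [map_add, map_mul, map_pow, hψ, map_one, map_intCast, map_ofNat] at this
    simp only [Units.coe_map, RingHom.toMonoidHom_eq_coe, MonoidHom.coe_coe,
      Units.val_pow_eq_pow_val, map_pow, rootUnit, hψ]
    push_cast
    linear_combination this
  · simp only [Units.coe_map, RingHom.toMonoidHom_eq_coe, MonoidHom.coe_coe, hw,
      map_add, map_mul, map_pow, hψ, map_one, map_intCast, map_ofNat]
  · intro m₁ m₂ m₃ hdvd
    obtain ⟨b', hb'⟩ := hb5
    have hb'' : (b : AdjoinRoot (quinticPoly ℤ_[5] ((4 * b ^ 4 : ℤ) : ℤ_[5]))) = 5 * (b' : ℤ) := by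
      exact_mod_cast congrArg Int.cast hb'
    obtain ⟨s, hs⟩ := hdvd
    have hd : (5 : AdjoinRoot (quinticPoly ℤ_[5] ((4 * b ^ 4 : ℤ) : ℤ_[5]))) ∣
        AdjoinRoot.mk _ (C (m₁ * a₄ + 2 * m₃) * X ^ 4 + C (m₁ * a₃) * X ^ 3 + C (m₁ * a₂) * X ^ 2 +
          C (m₁ * a₁ - m₂) * X + C 0) := by
      simp only [map_add, map_mul, map_sub, map_pow, AdjoinRoot.mk_X, AdjoinRoot.mk_C, ← hroot,
        ← AdjoinRoot.algebraMap_eq, map_intCast, map_ofNat, map_zero]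
      refine ⟨s - m₁ * r - m₃ * b' * (8 * b ^ 3 + 2 * (θ ^ 4 + 4 * b ^ 4) ^ 2), ?_⟩
      linear_combination hs - m₃ * (8 * b ^ 3 + 2 * (θ ^ 4 + 4 * b ^ 4) ^ 2) * hb''
    have key := five_dvd_of_five_dvd_quinticPoly hd
    have h1 : 5 ∣ m₁ := by
      rw [← five_dvd_intCast_iff]
      rcases ha with ha | ha
      · exact (prime_five_padicInt.dvd_or_dvd key.2.1).resolve_right ha
      · exact (prime_five_padicInt.dvd_or_dvd key.2.2.1).resolve_right ha
    have h1' := five_dvd_intCast_iff.2 h1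
    have h3 : (5 : ℤ_[5]) ∣ ((2 * m₃ : ℤ) : ℤ_[5]) := by
      push_cast
      exact (dvd_add_right (h1'.mul_right _)).1 key.2.2.2
    rw [five_dvd_intCast_iff] at h3
    exact ⟨h1, five_dvd_intCast_iff.1 ((dvd_sub_right (h1'.mul_right _)).1 key.1), by omega⟩

lemma five_dvd_sub_sub_one {m n c : ℤ} (hc : 5 ∣ c)
    (hmn : m ^ 5 + c * m * n ^ 4 - n ^ 5 = 1) : 5 ∣ m - n - 1 := by
  obtain ⟨c', rfl⟩ := hc
  have h1 : ((m ^ 5 + 5 * c' * m * n ^ 4 - n ^ 5 : ℤ) : ZMod 5) = (1 : ℤ) := congrArg _ hmn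
  have h5 : (5 : ZMod 5) = 0 := rfl
  push_cast at h1
  rw [ZMod.pow_card, ZMod.pow_card, h5] at h1
  refine (ZMod.intCast_zmod_eq_zero_iff_dvd _ 5).1 ?_
  push_cast
  linear_combination h1

lemma exists_mul_inv_eq {S : Type*} [CommRing S] {Q z R y' : S} {x y : Sˣ}
    (hxy : (x : S) - y = Q * (z + 5 * R)) (hy : (y : S) = 1 + 5 * y') : ∃ r, ((x * y⁻¹ : Sˣ) : S) = 1 + Q * (z + 5 * r) := by
  have hi := y.mul_inv
  rw [Units.val_mul]
  generalize ((y⁻¹ : Sˣ) : S) = i at *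
  rw [hy] at hi hxy
  exact ⟨R * i - z * y' * i, by linear_combination i * hxy + (1 + Q * z) * hi⟩

section Cases

variable {S : Type*} [CommRing S] [Algebra ℤ_[5] S] {θ : S}

lemma isTransverse_pow_five {m n c : ℤ} (hθ : θ ^ 5 + c * θ = 1) (hc : 25 ∣ c)
    (hmn : m ^ 5 + c * m * n ^ 4 - n ^ 5 = 1) (hm : ¬ 5 ∣ m) (hn : ¬ 5 ∣ n) {u : Sˣ}
    (hu : (u : S) = m - n * θ) : IsTransverse θ ((u ^ 5 : Sˣ) : S) := by
  obtain ⟨c', rfl⟩ := hc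
  refine ⟨5, dvd_rfl, by norm_num, -m ^ 4 * n, 2 * m ^ 3 * n ^ 2, -2 * m ^ 2 * n ^ 3, m * n ^ 4,
    c' * n ^ 4 * (n * θ - m), ?_, .inl ?_⟩
  · have h := congrArg (Int.cast (R := S)) hmn
    rw [Units.val_pow_eq_pow_val, hu]
    simp only [map_mul, map_neg, map_pow, map_intCast, map_ofNat]
    push_cast at h hθ ⊢
    linear_combination h - n ^ 5 * hθ
  · have h : ¬ (5 : ℤ_[5]) ∣ ((2 * m ^ 3 * n ^ 2 : ℤ) : ℤ_[5]) := by
      have hp : Prime (5 : ℤ) := by norm_num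
      rw [five_dvd_intCast_iff, hp.dvd_mul, hp.dvd_mul]
      rintro ((h | h) | h)
      · omega
      · exact hm (hp.dvd_of_dvd_pow h)
      · exact hn (hp.dvd_of_dvd_pow h)
    push_cast at h
    exact h

lemma exists_eq_one_add {m n c : ℤ} (hc : 5 ∣ c)
    (hmn : m ^ 5 + c * m * n ^ 4 - n ^ 5 = 1) (hn : 5 ∣ n) :
    ∃ μ : S, (m : S) = 1 + 5 * n ^ 2 * (n - c) * μ := by
  obtain ⟨l, hl⟩ : 5 ∣ m - 1 := by have := five_dvd_sub_sub_one hc hmn; omega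
  obtain ⟨c', rfl⟩ := hc
  obtain ⟨n', rfl⟩ := hn
  obtain rfl : m = 1 + 5 * l := by omega
  obtain ⟨i, hi⟩ := exists_intCast_mul_eq_one (S := S)
    (a := 1 + 5 * (2 * l + 10 * l ^ 2 + 25 * l ^ 3 + 25 * l ^ 4 + 125 * c' * n' ^ 4)) (by omega)
  have h : (1 + 5 * l - 1) * (1 + 5 * (2 * l + 10 * l ^ 2 + 25 * l ^ 3 + 25 * l ^ 4 +
      125 * c' * n' ^ 4)) = 5 * (5 * n') ^ 2 * (5 * n' - 5 * c') * n' ^ 2 :=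
    mul_left_cancel₀ (show (5 : ℤ) ≠ 0 by norm_num) (by linear_combination hmn)
  have h' := congrArg (Int.cast (R := S)) h
  refine ⟨n' ^ 2 * i, ?_⟩
  push_cast at h' hi ⊢
  linear_combination i * h' - 5 * l * hi

lemma isTransverse_zpow_mul_zpow {m n c : ℤ} (hc : 5 ∣ c) (hc0 : c ≠ 0)
    (hmn : m ^ 5 + c * m * n ^ 4 - n ^ 5 = 1) (hn : 5 ∣ n) (hn0 : n ≠ 0) (hnc : n - c ≠ 0)
    (hdvd : ((n - c : ℤ) : ℤ_[5]) ∣ c) {u v : Sˣ} (hu : (u : S) = m - n * θ)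
    (hv : (v : S) = 1 + c * (-θ)) : IsTransverse θ ((u ^ c * (v ^ n)⁻¹ : Sˣ) : S) := by
  obtain ⟨h, h6⟩ := exists_six_mul_eq_one (S := S)
  obtain ⟨μ, hμ⟩ := exists_eq_one_add (S := S) hc hmn hn
  obtain ⟨y, hy⟩ : ∃ y : S, y = -θ + 5 * n * (n - c) * μ := ⟨_, rfl⟩
  have hu' : (u : S) = 1 + n * y := by rw [hu, hμ, hy]; ring
  obtain ⟨r, hr⟩ := one_add_zpow_expansion h6 hn hu' c
  obtain ⟨r', hr'⟩ := one_add_zpow_expansion h6 hc hv n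
  obtain ⟨r₀, hr₀⟩ := one_add_zpow hc hv n
  obtain ⟨σ, hσ⟩ := hdvd
  replace hσ := congrArg (algebraMap ℤ_[5] S) hσ
  rw [map_mul, map_intCast, map_intCast] at hσ
  generalize algebraMap ℤ_[5] S σ = σ at *
  have hn' := hn
  have hc' := hc
  obtain ⟨n', rfl⟩ := hn'
  obtain ⟨c', rfl⟩ := hc'
  have hdiff : ((u ^ (5 * c') : Sˣ) : S) - ((v ^ (5 * n') : Sˣ) : S) =
      ((5 * c' * (5 * n') * (5 * n' - 5 * c') : ℤ) : S) * (-3 * h * θ ^ 2 + 5 * (5 * n' * μ +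
        3 * h * (5 * c' - 1) * (5 * n') *
          (-2 * (5 * n') * μ * θ + 5 * (5 * n') ^ 2 * (5 * n' - 5 * c') * μ ^ 2) +
        h * ((5 * c' - 1) * (5 * c' - 2) * y ^ 3 * n' * (σ + 1) +
          (5 * n' - 1) * (5 * n' - 2) * θ ^ 3 * c' * σ) +
        5 * n' * (σ + 1) * r - 5 * c' * σ * r')) := by
    push_cast at hr hr' hσ hy ⊢
    linear_combination hr - hr' + 5 * c' * (5 * n') * (
      h * (5 * c' - 1) * (5 * c' - 2) * y ^ 3 * (5 * n') +
      h * (5 * n' - 1) * (5 * n' - 2) * θ ^ 3 * (5 * c') + 5 * (5 * n') * r - 5 * (5 * c') * r') * hσ +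
      (5 * c' * (5 * n') + 3 * h * (5 * c') * (5 * c' - 1) * (5 * n') ^ 2 *
        (y - θ + 5 * (5 * n') * (5 * n' - 5 * c') * μ)) * hy
  obtain ⟨s, hs⟩ := exists_mul_inv_eq hdiff (y' := c' * (5 * n') * (-θ + 5 * r₀))
    (by rw [hr₀]; push_cast; ring)
  refine ⟨5 * c' * (5 * n') * (5 * n' - 5 * c'), (hc.mul_right _).mul_right _,
    mul_ne_zero (mul_ne_zero hc0 hn0) hnc, 0, -3, 0, 0, s + 3 * h * θ ^ 2, ?_, .inl ?_⟩
  · rw [hs]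
    simp only [map_neg, map_zero, map_ofNat]
    push_cast
    linear_combination -3 * (5 * c') * (5 * n') * (5 * n' - 5 * c') * θ ^ 2 * h6
  · exact_mod_cast mt five_dvd_intCast_iff.1 (show ¬ (5 : ℤ) ∣ -3 by norm_num)

lemma isTransverse_zpow_mul_zpow_of_dvd_sub {m n c : ℤ} (hc : 5 ∣ c)
    (hc0 : c ≠ 0) (hmn : m ^ 5 + c * m * n ^ 4 - n ^ 5 = 1) (hn : 5 ∣ n) (hnc : n - c ≠ 0)
    (hdvd : (5 * c : ℤ_[5]) ∣ (n - c : ℤ)) {u v : Sˣ} (hu : (u : S) = m - n * θ)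
    (hv : (v : S) = 1 + c * (-θ)) :
    IsTransverse θ (((u * v⁻¹) ^ c * (v ^ (n - c))⁻¹ : Sˣ) : S) := by
  obtain ⟨h, h6⟩ := exists_six_mul_eq_one (S := S)
  obtain ⟨μ, hμ⟩ := exists_eq_one_add (S := S) hc hmn hn
  obtain ⟨ρ, hρ⟩ := hdvd
  replace hρ := congrArg (algebraMap ℤ_[5] S) hρ
  rw [map_mul, map_mul, map_intCast, map_intCast, map_ofNat] at hρ
  generalize algebraMap ℤ_[5] S ρ = ρ at *
  obtain ⟨c', hc'⟩ := hc
  have hc'' : (c : S) = 5 * c' := by rw [hc']; push_cast; ring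
  have hvi := v.mul_inv
  have hu' : ((u * v⁻¹ : Sˣ) : S) = 1 + (n - c : ℤ) * (-θ - c * θ ^ 2 + 5 * c *
      (-c' * θ ^ 3 * (v⁻¹ : Sˣ) + c * (1 + 5 * ρ) ^ 2 * μ * (v⁻¹ : Sˣ))) := by
    rw [Units.val_mul]
    generalize ((v⁻¹ : Sˣ) : S) = i at *
    rw [hv] at hvi
    rw [hu, hμ]
    push_cast at hρ ⊢
    linear_combination (1 - (n - c) * (θ + c * θ ^ 2)) * hvi +
      5 * (n - c) * μ * i * (n + c * (1 + 5 * ρ)) * hρ - (n - c) * c * θ ^ 3 * i * hc''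
  generalize (-c' * θ ^ 3 * (v⁻¹ : Sˣ) + c * (1 + 5 * ρ) ^ 2 * μ * (v⁻¹ : Sˣ)) = κ at *
  obtain ⟨y, hy⟩ : ∃ y : S, y = -θ - c * θ ^ 2 + 5 * c * κ := ⟨_, rfl⟩
  rw [← hy] at hu'
  have hnc5 : 5 ∣ n - c := dvd_sub hn ⟨c', hc'⟩
  obtain ⟨r, hr⟩ := one_add_zpow_expansion h6 hnc5 hu' c
  obtain ⟨r', hr'⟩ := one_add_zpow_expansion h6 ⟨c', hc'⟩ hv (n - c)
  obtain ⟨r₀, hr₀⟩ := one_add_zpow ⟨c', hc'⟩ hv (n - c)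
  have hdiff : (((u * v⁻¹) ^ c : Sˣ) : S) - ((v ^ (n - c) : Sˣ) : S) =
      ((c * c * (n - c) : ℤ) : S) * ((3 * h - 1) * θ ^ 2 + 5 * (κ + 3 * h * (c - 1) * ρ * y ^ 2 +
        h * (c - 1) * (c - 2) * (n - c) * ρ * y ^ 3 + 5 * (n - c) * ρ * r - 3 * h * c * ρ * θ ^ 2 +
        h * (n - c - 1) * (n - c - 2) * c' * θ ^ 3 - c * r')) := by
    push_cast at hr hr' hρ ⊢
    linear_combination hr - hr' + c * (n - c) * hy + (3 * h * c * (c - 1) * (n - c) * y ^ 2 +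
      h * c * (c - 1) * (c - 2) * (n - c) ^ 2 * y ^ 3 + 5 * c * (n - c) ^ 2 * r -
      3 * h * (n - c) * c ^ 2 * θ ^ 2) * hρ + h * (n - c - 1) * (n - c - 2) * (n - c) *
      c ^ 2 * θ ^ 3 * hc''
  obtain ⟨s, hs⟩ := exists_mul_inv_eq hdiff (y' := (n - c) * c' * (-θ + 5 * r₀))
    (by rw [hr₀]; push_cast; linear_combination (n - c) * (-θ + 5 * r₀) * hc'')
  refine ⟨c * c * (n - c), hnc5.mul_left _, mul_ne_zero (mul_ne_zero hc0 hc0) hnc,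
    0, -3, 0, 0, s + 3 * h * θ ^ 2, ?_, .inl ?_⟩
  · rw [hs]
    simp only [map_neg, map_zero, map_ofNat]
    push_cast
    linear_combination -2 * c * c * (n - c) * θ ^ 2 * h6
  · exact_mod_cast mt five_dvd_intCast_iff.1 (show ¬ (5 : ℤ) ∣ -3 by norm_num)

lemma exists_neg_eq_one_add {b m n : ℤ} (hb : 5 ∣ b)
    (hmn : m ^ 5 + 4 * b ^ 4 * m * n ^ 4 - n ^ 5 = 1) (hm : 5 ∣ m) :
    ∃ κ₁ κ₂ : S, (-n : S) = 1 + 5 * m * (m * κ₁ + b ^ 2 * κ₂) := by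
  obtain ⟨l, hl⟩ : 5 ∣ -n - 1 := by
    have := five_dvd_sub_sub_one ((hb.trans (dvd_pow_self b (by norm_num))).mul_left 4) hmn
    omega
  obtain ⟨b', rfl⟩ := hb
  obtain ⟨m', rfl⟩ := hm
  obtain rfl : n = -(1 + 5 * l) := by omega
  obtain ⟨i, hi⟩ := exists_intCast_mul_eq_one (S := S)
    (a := 1 + 5 * (2 * l + 10 * l ^ 2 + 25 * l ^ 3 + 25 * l ^ 4)) (by omega)
  have h : 5 * l * (1 + 5 * (2 * l + 10 * l ^ 2 + 25 * l ^ 3 + 25 * l ^ 4)) =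
      -5 * (5 * m') * ((5 * m') * (m' ^ 2 * (5 * m')) +
        (5 * b') ^ 2 * (4 * b' ^ 2 * (1 + 5 * l) ^ 4)) :=
    mul_left_cancel₀ (show (5 : ℤ) ≠ 0 by norm_num) (by linear_combination hmn)
  have h' := congrArg (Int.cast (R := S)) h
  refine ⟨-i * m' ^ 2 * (5 * m'), -4 * i * b' ^ 2 * (1 + 5 * l) ^ 4, ?_⟩
  push_cast at h' hi ⊢
  linear_combination i * h' - 5 * l * hi

lemma exists_zpow_sub_zpow_eq {h : S} (h6 : 6 * h = 1) {b m : ℤ} (hb : 5 ∣ b) (hm : 5 ∣ m)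
    {φ κ₁ κ₂ : S} {u w : Sˣ} (hu : (u : S) = 1 + m * (φ + 5 * (m * κ₁ + b ^ 2 * κ₂)))
    (hw : (w : S) = 1 + b * (2 * φ + 2 * b * φ ^ 2)) :
    ∃ r₁ r₂ : S, ((u ^ (2 * b) : Sˣ) : S) - ((w ^ m : Sˣ) : S) =
      b * m ^ 2 * (-φ ^ 2 + 5 * r₁) + m * b ^ 3 * (8 * h * φ ^ 3 + 5 * r₂) := by
  obtain ⟨y, hy⟩ : ∃ y : S, y = φ + 5 * (m * κ₁ + b ^ 2 * κ₂) := ⟨_, rfl⟩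
  rw [← hy] at hu
  obtain ⟨r, hr⟩ := one_add_zpow_expansion h6 hm hu (2 * b)
  obtain ⟨r', hr'⟩ := one_add_zpow_expansion h6 hb hw m
  obtain ⟨b', hb'⟩ := hb
  obtain ⟨m', hm'⟩ := hm
  have hbS : (b : S) = 5 * b' := by rw [hb']; push_cast; ring
  have hmS : (m : S) = 5 * m' := by rw [hm']; push_cast; ring
  refine ⟨2 * κ₁ + (2 * b - 1) * (2 * φ * (m * κ₁ + b ^ 2 * κ₂) +
      5 * (m * κ₁ + b ^ 2 * κ₂) ^ 2) + 2 * h * m' * (2 * b - 1) * (2 * b - 2) * y ^ 3 + 2 * m * r,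
    2 * κ₂ - (4 * m' * φ ^ 3 + 2 * (m - 1) * b' * φ ^ 4 +
      8 * h * (m' * (m - 3) * φ ^ 3 * (1 + b * φ) ^ 3 +
        2 * φ ^ 3 * b' * (3 * φ + 3 * b * φ ^ 2 + b ^ 2 * φ ^ 3)) + r'), ?_⟩
  push_cast at hr
  linear_combination hr - hr' + (2 * b * m + 6 * h * b * (2 * b - 1) * m ^ 2 *
      (y + φ + 5 * (m * κ₁ + b ^ 2 * κ₂))) * hy +
    (b * (2 * b - 1) * m ^ 2 * (φ + 5 * (m * κ₁ + b ^ 2 * κ₂)) ^ 2 -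
      2 * m * (m - 1) * b ^ 2 * φ ^ 2 * (1 + b * φ) ^ 2 - 4 * m * b ^ 3 * φ ^ 3) * h6 +
    (2 * h * b * (2 * b - 1) * (2 * b - 2) * m ^ 2 * y ^ 3 - 4 * m * b ^ 3 * φ ^ 3 -
      8 * h * (m - 3) * φ ^ 3 * (1 + b * φ) ^ 3 * m * b ^ 3) * hmS -
    (2 * (m - 1) * φ ^ 4 * m * b ^ 3 +
      16 * h * φ ^ 3 * (3 * φ + 3 * b * φ ^ 2 + b ^ 2 * φ ^ 3) * m * b ^ 3) * hbS

lemma isTransverse_zpow_mul_zpow_of_five_dvd {b m n : ℤ} (hθ : θ ^ 5 + 4 * b ^ 4 * θ = 1)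
    (hb0 : b ≠ 0) (hb : 5 ∣ b) (hmn : m ^ 5 + 4 * b ^ 4 * m * n ^ 4 - n ^ 5 = 1) (hm0 : m ≠ 0)
    (hm : 5 ∣ m) {t u w : Sˣ} (ht : (t : S) = θ) (hu : (u : S) = m - n * θ)
    (hw : (w : S) = 1 + b * (2 * (θ ^ 4 + 4 * b ^ 4) + 2 * b * (θ ^ 4 + 4 * b ^ 4) ^ 2)) :
    IsTransverse θ (((u * t⁻¹) ^ (2 * b) * (w ^ m)⁻¹ : Sˣ) : S) := by
  obtain ⟨h, h6⟩ := exists_six_mul_eq_one (S := S)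
  obtain ⟨κ₁, κ₂, hκ⟩ := exists_neg_eq_one_add (S := S) hb hmn hm
  have hinv : ((t⁻¹ : Sˣ) : S) = θ ^ 4 + 4 * b ^ 4 := by
    have := t.mul_inv
    rw [ht] at this
    linear_combination (θ ^ 4 + 4 * b ^ 4) * this - ((t⁻¹ : Sˣ) : S) * hθ
  obtain ⟨φ, hφ⟩ : ∃ φ : S, φ = θ ^ 4 + 4 * b ^ 4 := ⟨_, rfl⟩
  rw [← hφ] at hinv hw
  have hφ2 : φ ^ 2 = θ ^ 3 + 4 * b ^ 4 * θ ^ 4 + (4 * b ^ 4) ^ 2 := by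
    rw [hφ]; linear_combination θ ^ 3 * hθ
  have hφ3 : φ ^ 3 = θ ^ 2 + 4 * b ^ 4 * φ ^ 2 := by
    rw [hφ]; linear_combination (θ ^ 2 * (θ * (θ ^ 4 + 4 * b ^ 4) + 1)) * hθ
  have hu' : ((u * t⁻¹ : Sˣ) : S) = 1 + m * (φ + 5 * (m * κ₁ + b ^ 2 * κ₂)) := by
    rw [Units.val_mul, hu, hinv, hφ]
    linear_combination hκ - n * hθ
  obtain ⟨r₁, r₂, hdiff⟩ := exists_zpow_sub_zpow_eq h6 hb hm hu' hw
  obtain ⟨r₀, hr₀⟩ := one_add_zpow hb hw m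
  obtain ⟨b', hb'⟩ := id hb
  obtain ⟨m', hm'⟩ := id hm
  have hbS : (b : S) = 5 * b' := by rw [hb']; push_cast; ring
  have hmS : (m : S) = 5 * m' := by rw [hm']; push_cast; ring
  have hwm : ((w ^ m : Sˣ) : S) = 1 + 5 * (m' * b * (2 * φ + 2 * b * φ ^ 2 + 5 * r₀)) := by
    rw [hr₀, hmS]; ring
  rcases ValuationRing.dvd_total (m : ℤ_[5]) (b ^ 2 : ℤ) with ⟨σ, hσ⟩ | ⟨σ, hσ⟩
  · have hσS : (b : S) ^ 2 = m * algebraMap ℤ_[5] S σ := by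
      simpa using congrArg (algebraMap ℤ_[5] S) hσ
    obtain ⟨s, hs⟩ := exists_mul_inv_eq (x := (u * t⁻¹) ^ (2 * b)) (Q := (b : S) * m ^ 2)
      (z := -φ ^ 2 + 8 * h * algebraMap ℤ_[5] S σ * φ ^ 3)
      (R := r₁ + algebraMap ℤ_[5] S σ * r₂)
      (by linear_combination hdiff + m * b * (8 * h * φ ^ 3 + 5 * r₂) * hσS) hwm
    refine ⟨b * m ^ 2, hb.mul_right _, mul_ne_zero hb0 (pow_ne_zero _ hm0), 0, 8 * σ, -1, 0,
      s + 8 * h * algebraMap ℤ_[5] S σ * (4 * b ^ 3 * b' * φ ^ 2 - θ ^ 2) -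
        4 * b ^ 3 * b' * (θ ^ 4 + 4 * b ^ 4), ?_, .inr ?_⟩
    · rw [hs]
      simp only [map_neg, map_zero, map_one, map_mul, map_ofNat]
      push_cast
      linear_combination b * m ^ 2 * (8 * h * algebraMap ℤ_[5] S σ * hφ3 - hφ2 +
        8 * algebraMap ℤ_[5] S σ * θ ^ 2 * h6 +
        (32 * h * algebraMap ℤ_[5] S σ * b ^ 3 * φ ^ 2 - 4 * b ^ 3 * θ ^ 4 - 16 * b ^ 7) * hbS)
    · exact_mod_cast mt five_dvd_intCast_iff.1 (show ¬ (5 : ℤ) ∣ -1 by norm_num)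
  · have hσS : (m : S) = b ^ 2 * algebraMap ℤ_[5] S σ := by
      simpa using congrArg (algebraMap ℤ_[5] S) hσ
    obtain ⟨s, hs⟩ := exists_mul_inv_eq (x := (u * t⁻¹) ^ (2 * b)) (Q := (m : S) * b ^ 3)
      (z := -algebraMap ℤ_[5] S σ * φ ^ 2 + 8 * h * φ ^ 3)
      (R := algebraMap ℤ_[5] S σ * r₁ + r₂)
      (by linear_combination hdiff + b * m * (-φ ^ 2 + 5 * r₁) * hσS) hwm
    refine ⟨m * b ^ 3, hm.mul_right _, mul_ne_zero hm0 (pow_ne_zero _ hb0), 0, 8, -σ, 0,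
      s + 8 * h * (4 * b ^ 3 * b' * φ ^ 2 - θ ^ 2) -
        algebraMap ℤ_[5] S σ * (4 * b ^ 3 * b' * (θ ^ 4 + 4 * b ^ 4)), ?_, .inl ?_⟩
    · rw [hs]
      simp only [map_neg, map_zero, map_ofNat]
      push_cast
      linear_combination m * b ^ 3 * (8 * h * hφ3 - algebraMap ℤ_[5] S σ * hφ2 + 8 * θ ^ 2 * h6 +
        (32 * h * b ^ 3 * φ ^ 2 - algebraMap ℤ_[5] S σ * (4 * b ^ 3 * θ ^ 4 + 16 * b ^ 7)) * hbS)
    · exact_mod_cast mt five_dvd_intCast_iff.1 (show ¬ (5 : ℤ) ∣ 8 by norm_num)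

end Cases

lemma exists_ringHom_padicInt (c : ℤ) :
    ∃ ψ : AdjoinRoot (quinticPoly ℤ c) →+* AdjoinRoot (quinticPoly ℤ_[5] (c : ℤ_[5])),
      ψ (AdjoinRoot.root _) = AdjoinRoot.root _ := by
  refine ⟨AdjoinRoot.lift (Int.castRingHom _) (AdjoinRoot.root _) ?_, AdjoinRoot.lift_root _⟩
  have h := root_quinticPoly (c : ℤ_[5])
  rw [map_intCast] at h
  rw [eval₂_quinticPoly, eq_intCast]
  linear_combination h

lemma eq_zero_or_eq_of_quintic_eq {b m n : ℤ} (hb : b ≠ 0) (hb5 : 5 ∣ b)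
    (hmn : m ^ 5 + 4 * b ^ 4 * m * n ^ 4 - n ^ 5 = 1) : m = 0 ∨ n = 0 ∨ n = 4 * b ^ 4 := by
  by_contra! hcon
  obtain ⟨hm0, hn0, hnc⟩ := hcon
  obtain ⟨ψ, hψ⟩ := exists_ringHom_padicInt (4 * b ^ 4)
  set θ := AdjoinRoot.root (quinticPoly ℤ_[5] ((4 * b ^ 4 : ℤ) : ℤ_[5])) with hroot
  have hθ := root_quinticPoly (4 * b ^ 4)
  have hθ' := root_quinticPoly ((4 * b ^ 4 : ℤ) : ℤ_[5])
  have hmnR := congrArg (Int.cast (R := AdjoinRoot (quinticPoly ℤ (4 * b ^ 4)))) hmn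
  rw [eq_intCast] at hθ
  rw [map_intCast, ← hroot] at hθ'
  have hθ'' := hθ'
  push_cast at hθ hθ'' hmnR
  obtain ⟨u, hu⟩ := isUnit_sub_mul_root hθ hmnR
  obtain ⟨w, hw⟩ := isUnit_one_add_inv_root hθ
  let t := rootUnit hθ
  let f := Units.map ψ.toMonoidHom
  have hH : ∀ x, ¬ IsTransverse θ (f x).val :=
    not_isTransverse hb hb5 ψ hψ
  have hfu : (f u).val = m - n * θ := by
    change ψ u = _
    rw [hu, map_sub, map_mul, hψ, map_intCast, map_intCast]
  have hft : (f t).val = θ := hψ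
  have hfv : (f t ^ 5).val = 1 + (4 * b ^ 4 : ℤ) * (-θ) := by
    rw [Units.val_pow_eq_pow_val, hft]
    linear_combination hθ'
  have hfw : (f w).val = 1 + b * (2 * (θ ^ 4 +
      4 * b ^ 4) + 2 * b * (θ ^ 4 + 4 * b ^ 4) ^ 2) := by
    change ψ w = _
    simp only [hw, map_add, map_mul, map_pow, hψ, map_one, map_intCast, map_ofNat]
  have hc0 : 4 * b ^ 4 ≠ 0 := by positivity
  have hc25 : 25 ∣ 4 * b ^ 4 := by
    obtain ⟨b', rfl⟩ := hb5
    exact ⟨100 * b' ^ 4, by ring⟩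
  have hc5 : 5 ∣ 4 * b ^ 4 := by omega
  by_cases hm : 5 ∣ m
  · refine hH ((u * t⁻¹) ^ (2 * b) * (w ^ m)⁻¹) ?_
    simpa only [map_mul, map_inv, map_zpow] using
      isTransverse_zpow_mul_zpow_of_five_dvd hθ'' hb hb5 hmn hm0 hm hft hfu hfw
  by_cases hn : 5 ∣ n
  · rcases intCast_dvd_or_five_mul_dvd (4 * b ^ 4) (n - 4 * b ^ 4) with hdvd | hdvd
    · refine hH (u ^ (4 * b ^ 4) * ((t ^ 5) ^ n)⁻¹) ?_
      simpa only [map_mul, map_inv, map_zpow, map_pow] using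
        isTransverse_zpow_mul_zpow hc5 hc0 hmn hn hn0 (sub_ne_zero.2 hnc) hdvd hfu hfv
    · refine hH ((u * (t ^ 5)⁻¹) ^ (4 * b ^ 4) * ((t ^ 5) ^ (n - 4 * b ^ 4))⁻¹) ?_
      simpa only [map_mul, map_inv, map_zpow, map_pow] using
        isTransverse_zpow_mul_zpow_of_dvd_sub hc5 hc0 hmn hn (sub_ne_zero.2 hnc) hdvd hfu hfv
  · refine hH (u ^ 5) ?_
    simpa only [map_pow] using isTransverse_pow_five hθ' hc25 hmn hm hn hfu

end QuinticThue

/-- **Theorem (Main).** Let `b` be a nonzero integer divisible by 5. The Thue equation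
`m^5 + 4*b^4*m*n^4 - n^5 = 1` has exactly three integral solutions, namely
`(1, 0)`, `(0, -1)` and `(1, 4*b^4)`. -/
theorem quintic_thue_solutions (b : ℤ) (hb : b ≠ 0) (hb5 : (5 : ℤ) ∣ b) :
    {p : ℤ × ℤ | p.1 ^ 5 + 4 * b ^ 4 * p.1 * p.2 ^ 4 - p.2 ^ 5 = 1} =
      {(1, 0), (0, -1), (1, 4 * b ^ 4)} := by
  ext ⟨m, n⟩
  simp only [Set.mem_ofPred_eq, Set.mem_insert_iff, Set.mem_singleton_iff, Prod.mk.injEq]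
  constructor
  · intro hmn
    have hodd : Odd 5 := by decide
    rcases QuinticThue.eq_zero_or_eq_of_quintic_eq hb hb5 hmn with rfl | rfl | rfl
    · right; left
      have h : n ^ 5 = (-1) ^ 5 := by linear_combination -hmn
      exact ⟨rfl, hodd.pow_injective h⟩
    · left
      have h : m ^ 5 = 1 ^ 5 := by linear_combination hmn
      exact ⟨hodd.pow_injective h, rfl⟩
    · right; right
      refine ⟨?_, rfl⟩
      have h : (m - 1) * (m ^ 4 + m ^ 3 + m ^ 2 + m + 1 + (4 * b ^ 4) ^ 5) = 0 := by
        linear_combination hmn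
      have hpos : 0 < m ^ 4 + m ^ 3 + m ^ 2 + m + 1 + (4 * b ^ 4) ^ 5 := by
        have : 0 < (4 * b ^ 4) ^ 5 := by positivity
        nlinarith [sq_nonneg (2 * m ^ 2 + m), sq_nonneg (m + 1), sq_nonneg m]
      linarith [(mul_eq_zero.1 h).resolve_right hpos.ne']
  · rintro (⟨rfl, rfl⟩ | ⟨rfl, rfl⟩ | ⟨rfl, rfl⟩) <;> ring
end

section
/- Let d be a cube-free integer (i.e., no cube of a prime number divides d). Then the equation x^3 - d*y^3 = 1 has at most 2 solutions in integers (x, y). -/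
open Polynomial NumberField

theorem one_add_three_mul_pow {R : Type*} [CommRing R] (w : R) (a s : ℕ) :
    ∃ q : R, (1 + 3 * w) ^ (3 ^ a * s) =
      1 + 3 ^ (a + 1) * (s * w) + 3 ^ (a + 2) * (w ^ 2 * q) := by
  induction a with
  | zero =>
    induction s with
    | zero => exact ⟨0, by simp⟩
    | succ s ih =>
      obtain ⟨q, hq⟩ := ih
      refine ⟨q + s + 3 * w * q, ?_⟩
      rw [pow_zero, one_mul] at hq ⊢
      rw [pow_succ, hq]
      push_cast
      ring
  | succ a ih =>
    obtain ⟨q, hq⟩ := ih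
    refine ⟨q + 3 ^ a * (s + 3 * w * q) ^ 2 + 3 ^ (2 * a) * w * (s + 3 * w * q) ^ 3, ?_⟩
    rw [show 3 ^ (a + 1) * s = 3 ^ a * s * 3 by ring, pow_mul, hq]
    ring

theorem one_add_three_mul_pow_three_pow {R : Type*} [CommRing R] (w : R) (N k : ℕ) :
    ∃ q : R, (1 + 3 * w) ^ (3 ^ N * k) = 1 + 3 ^ (N + 1) * q := by
  obtain ⟨q, hq⟩ := one_add_three_mul_pow w N k
  exact ⟨k * w + 3 * (w ^ 2 * q), by rw [hq]; ring⟩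

section Binomial

variable {R : Type*} [CommRing R] {θ : R} {d x y : ℤ}

theorem binomial_cube (hθ : θ ^ 3 = d) (hxy : x ^ 3 - d * y ^ 3 = 1) :
    ((x : R) - y * θ) ^ 3 = 1 + 3 * (-(x * y) * θ * (x - y * θ)) := by
  have h : (x : R) ^ 3 - d * y ^ 3 = 1 := by
    simpa using congrArg (Int.cast : ℤ → R) hxy
  linear_combination h - (y : R) ^ 3 * hθ

theorem three_pow_dvd_of_dvd_mul {N : ℕ} {u v : ℤ} (hv : ¬ (3 : ℤ) ∣ v)
    (h : (3 : ℤ) ^ N ∣ u * v) : (3 : ℤ) ^ N ∣ u :=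
  ((Int.prime_three.coprime_iff_not_dvd).2 hv).pow_left.dvd_of_dvd_mul_right h

variable (c : R →+ ℤ)

theorem map_intCast_mul (n : ℤ) (z : R) : c (n * z) = n * c z := by
  rw [← zsmul_eq_mul, map_zsmul, smul_eq_mul]

/-- If the `θ ^ 2`-coordinate of `(x - y θ) ^ t` is divisible by `3 ^ N`, then so is one of three
explicit integers, according to the residue of `t` modulo `3`. -/
theorem three_pow_dvd_of_dvd_coord (hθ : θ ^ 3 = d) (h0 : c 1 = 0) (h1 : c θ = 0)
    (h2 : c (θ ^ 2) = 1) (hxy : x ^ 3 - d * y ^ 3 = 1) {t N : ℕ}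
    (h : (3 : ℤ) ^ N ∣ c ((x - y * θ) ^ t)) :
    (3 : ℤ) ^ N ∣ t * (x * y ^ 2) ∨ (3 : ℤ) ^ N ∣ (t - 1) * (2 * x ^ 2 * y ^ 2) ∨
      (3 : ℤ) ^ N ∣ y ^ 2 := by
  have hR : (x : R) ^ 3 - d * y ^ 3 = 1 := by
    simpa using congrArg (Int.cast : ℤ → R) hxy
  have hcoord (p q r : ℤ) : c (p + q * θ + r * θ ^ 2) = r := by
    have := map_intCast_mul c p 1
    rw [mul_one] at this
    rw [map_add, map_add, this, map_intCast_mul, map_intCast_mul, h0, h1, h2]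
    ring
  obtain ⟨s, r, hr, rfl⟩ : ∃ s r, r < 3 ∧ t = 3 * s + r :=
    ⟨t / 3, t % 3, Nat.mod_lt _ (by norm_num), (Nat.div_add_mod t 3).symm⟩
  rw [pow_add, pow_mul, binomial_cube hθ hxy] at h
  obtain rfl | hr2 := (by omega : r = 2 ∨ r < 2)
  · right; right
    obtain ⟨q, hq⟩ := one_add_three_mul_pow (-(x * y) * θ * (x - y * θ)) 0 s
    rw [pow_zero, one_mul] at hq
    have e : (1 + 3 * (-(x * y) * θ * (x - y * θ))) ^ s * (x - y * θ) ^ 2 =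
        ((x ^ 2 - 9 * s * x ^ 2 * y ^ 3 * d : ℤ) : R)
        + ((-2 * x * y - 3 * s * x * y : ℤ) : R) * θ
        + ((y ^ 2 + 9 * s * x ^ 3 * y ^ 2 : ℤ) : R) * θ ^ 2
        + ((9 * x ^ 2 * y ^ 2 : ℤ) : R) *
          ((θ * (x - y * θ)) ^ 2 * q * (x - y * θ) ^ 2) := by
      rw [hq]; push_cast
      linear_combination (-9 * s * x ^ 2 * y ^ 3 + 3 * s * x * y ^ 4 * θ : R) * hθ
        - (3 * s * x * y * θ : R) * hR
    rw [e, map_add, hcoord, map_intCast_mul] at h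
    set k := c ((θ * (x - y * θ)) ^ 2 * q * (x - y * θ) ^ 2)
    have hv : ¬ (3 : ℤ) ∣ 1 + 3 * (3 * s * x ^ 3 + 3 * x ^ 2 * k) := by omega
    exact three_pow_dvd_of_dvd_mul hv (by obtain ⟨z, hz⟩ := h; exact ⟨z, by linear_combination hz⟩)
  rcases Nat.eq_zero_or_pos s with rfl | hs
  · interval_cases r
    · left; simp
    · right; left; simp
  obtain ⟨a, s, hs3, rfl⟩ := Nat.exists_eq_pow_mul_and_not_dvd hs.ne' 3 (by norm_num)
  obtain ⟨q, hq⟩ := one_add_three_mul_pow (-(x * y) * θ * (x - y * θ)) a s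
  have hs3' : ¬ (3 : ℤ) ∣ s := by exact_mod_cast hs3
  interval_cases r
  · left
    have e : (1 + 3 * (-(x * y) * θ * (x - y * θ))) ^ (3 ^ a * s) * (x - y * θ) ^ 0 =
        ((1 : ℤ) : R) + ((-3 ^ (a + 1) * s * x ^ 2 * y : ℤ) : R) * θ
        + ((3 ^ (a + 1) * s * x * y ^ 2 : ℤ) : R) * θ ^ 2
        + ((3 ^ (a + 2) * x ^ 2 * y ^ 2 : ℤ) : R) * ((θ * (x - y * θ)) ^ 2 * q) := by
      rw [hq]; push_cast; ring
    rw [e, map_add, hcoord, map_intCast_mul] at h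
    set k := c ((θ * (x - y * θ)) ^ 2 * q)
    have hv : ¬ (3 : ℤ) ∣ s + 3 * (x * k) := by omega
    have := (three_pow_dvd_of_dvd_mul (N := N) (u := 3 ^ (a + 1) * (x * y ^ 2)) hv
      (by obtain ⟨z, hz⟩ := h; exact ⟨z, by linear_combination hz⟩)).mul_right s
    obtain ⟨z, hz⟩ := this
    exact ⟨z, by push_cast; linear_combination hz⟩
  · right; left
    have e : (1 + 3 * (-(x * y) * θ * (x - y * θ))) ^ (3 ^ a * s) * (x - y * θ) ^ 1 =
        ((x - 3 ^ (a + 1) * s * x * y ^ 3 * d : ℤ) : R)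
        + ((-y - 3 ^ (a + 1) * s * x ^ 3 * y : ℤ) : R) * θ
        + ((3 ^ (a + 1) * s * 2 * x ^ 2 * y ^ 2 : ℤ) : R) * θ ^ 2
        + ((3 ^ (a + 2) * x ^ 2 * y ^ 2 : ℤ) : R) *
          ((θ * (x - y * θ)) ^ 2 * q * (x - y * θ)) := by
      rw [hq]; push_cast
      linear_combination (-3 ^ (a + 1) * s * x * y ^ 3 : R) * hθ
    rw [e, map_add, hcoord, map_intCast_mul] at h
    set k := c ((θ * (x - y * θ)) ^ 2 * q * (x - y * θ))
    have hv : ¬ (3 : ℤ) ∣ 2 * s + 3 * k := by omega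
    have := (three_pow_dvd_of_dvd_mul (N := N) (u := 3 ^ (a + 1) * (x ^ 2 * y ^ 2)) hv
      (by obtain ⟨z, hz⟩ := h; exact ⟨z, by linear_combination hz⟩)).mul_right (2 * s)
    obtain ⟨z, hz⟩ := this
    exact ⟨z, by push_cast; linear_combination hz⟩

theorem eq_zero_of_three_pow_dvd {N : ℕ} {z : ℤ} (hN : z.natAbs ≤ N) (h : (3 : ℤ) ^ N ∣ z) :
    z = 0 := by
  refine Int.eq_zero_of_dvd_of_natAbs_lt_natAbs h ?_
  rw [Int.natAbs_pow]
  exact hN.trans_lt (Nat.lt_pow_self (by norm_num))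

theorem exponents_eq_of_binomial_pow_eq (hθ : θ ^ 3 = d) (h0 : c 1 = 0) (h1 : c θ = 0)
    (h2 : c (θ ^ 2) = 1) (hxy : x ^ 3 - d * y ^ 3 = 1) (hx : x ≠ 0) (hy : y ≠ 0)
    {x' y' : ℤ} (hxy' : x' ^ 3 - d * y' ^ 3 = 1) {m n : ℕ} (hm : m ≠ 0) (hn : ¬ 3 ∣ n)
    (h : ((x : R) - y * θ) ^ m = (x' - y' * θ) ^ n) : m = n := by
  obtain ⟨N, hN0, hN1, hN2, hN3⟩ : ∃ N : ℕ, 1 ≤ N ∧ ((m : ℤ) * (x * y ^ 2)).natAbs ≤ N ∧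
      ((m - n : ℤ) * (2 * x ^ 2 * y ^ 2)).natAbs ≤ N ∧ (y ^ 2).natAbs ≤ N :=
    ⟨1 + ((m : ℤ) * (x * y ^ 2)).natAbs + ((m - n : ℤ) * (2 * x ^ 2 * y ^ 2)).natAbs +
      (y ^ 2).natAbs, by omega, by omega, by omega, by omega⟩
  obtain ⟨M, rfl⟩ := Nat.exists_eq_add_of_le' hN0
  obtain ⟨n', -, hn'⟩ := Nat.exists_mul_mod_eq_one_of_coprime (k := 3 ^ (M + 1))
    (((Nat.Prime.coprime_iff_not_dvd Nat.prime_three).2 hn).symm.pow_right (M + 1))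
    (Nat.one_lt_pow (by omega) (by norm_num))
  obtain ⟨k, hk⟩ : ∃ k, n * n' = 3 ^ (M + 1) * k + 1 :=
    ⟨n * n' / 3 ^ (M + 1), by
      conv_lhs => rw [← Nat.div_add_mod (n * n') (3 ^ (M + 1)), hn']⟩
  have hc : (3 : ℤ) ^ (M + 1) ∣ c ((x - y * θ) ^ (m * n')) := by
    obtain ⟨q, hq⟩ := one_add_three_mul_pow_three_pow (-(x' * y') * θ * (x' - y' * θ)) M k
    have e : ((x : R) - y * θ) ^ (m * n') = (x' : R) * 1 + ((-y' : ℤ) : R) * θ +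
        ((3 ^ (M + 1) : ℤ) : R) * (q * (x' - y' * θ)) := by
      rw [pow_mul, h, ← pow_mul, hk, pow_succ, pow_succ', mul_assoc, pow_mul,
        binomial_cube hθ hxy', hq]
      push_cast
      ring
    rw [e, map_add, map_add, map_intCast_mul, map_intCast_mul, map_intCast_mul, h0, h1]
    simp
  have ht : (3 : ℤ) ^ (M + 1) ∣ m * n' * n - m :=
    ⟨m * k, by have : (n * n' : ℤ) = 3 ^ (M + 1) * k + 1 := by exact_mod_cast hk
               linear_combination m * this⟩
  have key := three_pow_dvd_of_dvd_coord c hθ h0 h1 h2 hxy hc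
  push_cast at key
  obtain h | h | h := key
  · have := eq_zero_of_three_pow_dvd hN1 <| by
      obtain ⟨z, hz⟩ := (h.mul_right n).sub (ht.mul_right (x * y ^ 2))
      exact ⟨z, by linear_combination hz⟩
    simp_all
  · have := eq_zero_of_three_pow_dvd hN2 <| by
      obtain ⟨z, hz⟩ := (h.mul_right n).sub (ht.mul_right (2 * x ^ 2 * y ^ 2))
      exact ⟨z, by linear_combination hz⟩
    have h' : (m - n : ℤ) = 0 := by simpa [hx, hy] using this
    omega
  · have := eq_zero_of_three_pow_dvd hN3 h
    simp_all

end Binomial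

theorem exists_real_cube_root (a : ℝ) : ∃ r : ℝ, r ^ 3 = a := by
  have hpos (b : ℝ) (hb : 0 ≤ b) : (b ^ ((3 : ℕ) : ℝ)⁻¹) ^ 3 = b :=
    Real.rpow_inv_natCast_pow hb (by norm_num)
  obtain ha | ha := le_total 0 a
  · exact ⟨_, hpos a ha⟩
  · exact ⟨-_, by rw [Odd.neg_pow (by decide), hpos (-a) (by linarith), neg_neg]⟩

theorem rank_units_adjoinRoot_cubic {a : ℚ} [Fact (Irreducible (X ^ 3 - C a : ℚ[X]))]
    [NumberField (AdjoinRoot (X ^ 3 - C a : ℚ[X]))] :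
    Units.rank (AdjoinRoot (X ^ 3 - C a : ℚ[X])) = 1 := by
  have hirr : Irreducible (X ^ 3 - C a : ℚ[X]) := Fact.out
  have hfin : Module.finrank ℚ (AdjoinRoot (X ^ 3 - C a : ℚ[X])) = 3 := by
    rw [(AdjoinRoot.powerBasis hirr.ne_zero).finrank, AdjoinRoot.powerBasis_dim,
      natDegree_X_pow_sub_C]
  obtain ⟨r, hr⟩ := exists_real_cube_root a
  have hr0 : r ≠ 0 := by
    rintro rfl
    have ha : a = 0 := by
      rw [zero_pow (by norm_num)] at hr
      exact_mod_cast hr.symm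
    rw [ha, C_0, sub_zero] at hirr
    exact not_irreducible_pow (by norm_num) hirr
  let z : ℂ := ⟨-r / 2, r * √3 / 2⟩
  have hz : z ^ 3 = (a : ℂ) := by
    have h3 : (√3) ^ 2 = 3 := Real.sq_sqrt (by norm_num)
    have : ((a : ℝ) : ℂ) = a := by norm_cast
    rw [← this, ← hr]
    apply Complex.ext
    · simp [z, pow_succ]
      linear_combination (-3 * r ^ 3 / 8) * -h3
    · simp [z, pow_succ]
      linear_combination (-r ^ 3 / 8 * √3) * h3
  let ψ : AdjoinRoot (X ^ 3 - C a : ℚ[X]) →+* ℂ :=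
    AdjoinRoot.lift (algebraMap ℚ ℂ) z (by simp [hz])
  have hpos : InfinitePlace.nrComplexPlaces (AdjoinRoot (X ^ 3 - C a : ℚ[X])) ≠ 0 := by
    rw [Ne, nrComplexPlaces_eq_zero_iff]
    intro hreal
    have h := ComplexEmbedding.isReal_iff.1 (IsTotallyReal.complexEmbedding_isReal ψ)
    have h' := congrArg Complex.im (RingHom.congr_fun h (AdjoinRoot.root _))
    simp [ψ, z, ComplexEmbedding.conjugate_coe_eq] at h'
    have : r * √3 ≠ 0 := by positivity
    apply this
    linarith
  have h1 := InfinitePlace.card_add_two_mul_card_eq_rank (AdjoinRoot (X ^ 3 - C a : ℚ[X]))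
  have h2 := InfinitePlace.card_eq_nrRealPlaces_add_nrComplexPlaces
    (AdjoinRoot (X ^ 3 - C a : ℚ[X]))
  rw [Units.rank]
  omega

/-- In a number field of unit rank one with a real embedding, two units whose real images lie
strictly between `0` and `1` have a common positive power. -/
theorem exists_pow_eq_pow_of_rank_eq_one {K : Type*} [Field K] [NumberField K]
    (hK : Units.rank K = 1) (φ : K →+* ℝ) (u v : (𝓞 K)ˣ)
    (hu0 : 0 < φ u) (hu1 : φ u < 1) (hv0 : 0 < φ v) (hv1 : φ v < 1) :
    ∃ m n : ℕ, m ≠ 0 ∧ n ≠ 0 ∧ φ u ^ m = φ v ^ n := by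
  obtain ⟨E, hE, H⟩ : ∃ E : ℝ, 0 < E ∧ ∀ w : (𝓞 K)ˣ, ∃ k : ℤ, |φ w| = E ^ k := by
    let i : Fin (Units.rank K) := ⟨0, by omega⟩
    have hi (j : Fin (Units.rank K)) : j = i := Fin.ext (by simp [i]; omega)
    refine ⟨|φ (Units.fundSystem K i)|, by simp, fun w ↦ ?_⟩
    obtain ⟨⟨ζ, e⟩, h, -⟩ := Units.exist_unique_eq_mul_prod K w
    refine ⟨e i, ?_⟩
    have hζ : |φ (ζ : (𝓞 K)ˣ)| = 1 := by
      have := (Units.mem_torsion K).1 ζ.2 (InfinitePlace.mk (Complex.ofRealHom.comp φ))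
      simpa [InfinitePlace.apply] using this
    have hprod : ∏ j, Units.fundSystem K j ^ e j = Units.fundSystem K i ^ e i :=
      Finset.prod_eq_single i (fun j _ hj ↦ (hj (hi j)).elim) (by simp)
    rw [h]
    simp only [hprod, Units.val_mul, map_mul, abs_mul, hζ, one_mul]
    rw [Units.coe_zpow, map_zpow₀, abs_zpow]
  obtain ⟨k, hk⟩ := H u
  obtain ⟨l, hl⟩ := H v
  rw [abs_of_pos hu0] at hk
  rw [abs_of_pos hv0] at hl
  have hk0 : k ≠ 0 := by rintro rfl; simp at hk; linarith
  have hl0 : l ≠ 0 := by rintro rfl; simp at hl; linarith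
  have hrel : φ u ^ l = φ v ^ k := by rw [hk, hl, ← zpow_mul, ← zpow_mul, mul_comm]
  have hsame : φ u ^ (l.natAbs) = φ v ^ (k.natAbs) := by
    obtain ⟨k, rfl | rfl⟩ := k.eq_nat_or_neg <;> obtain ⟨l, rfl | rfl⟩ := l.eq_nat_or_neg
    · simpa using hrel
    · exfalso
      simp only [zpow_neg, zpow_natCast] at hrel
      have h1 := pow_lt_one₀ hu0.le hu1 (n := l) (by simpa using hl0)
      have h2 := pow_lt_one₀ hv0.le hv1 (n := k) (by simpa using hk0)
      have := (one_lt_inv₀ (pow_pos hu0 l)).2 h1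
      linarith
    · exfalso
      simp only [zpow_neg, zpow_natCast] at hrel
      have h1 := pow_lt_one₀ hu0.le hu1 (n := l) (by simpa using hl0)
      have h2 := pow_lt_one₀ hv0.le hv1 (n := k) (by simpa using hk0)
      have := (one_lt_inv₀ (pow_pos hv0 k)).2 h2
      linarith
    · simpa using hrel
  exact ⟨_, _, by simpa using hl0, by simpa using hk0, hsame⟩

theorem binomial_pos_lt_one {d x y : ℤ} {r : ℝ} (hr : r ^ 3 = d) (hr0 : r ≠ 0)
    (hxy : x ^ 3 - d * y ^ 3 = 1) (hx : x ≠ 0) (hy : y ≠ 0) :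
    0 < x - y * r ∧ x - y * r < 1 := by
  have h : (x : ℝ) ^ 3 - (y * r) ^ 3 = 1 := by
    rw [mul_pow, hr]
    have := congrArg (Int.cast : ℤ → ℝ) hxy
    push_cast at this
    linarith
  set b := (y : ℝ) * r
  have hb : b ≠ 0 := mul_ne_zero (by exact_mod_cast hy) hr0
  have hfac : ((x : ℝ) - b) * (x ^ 2 + x * b + b ^ 2) = 1 := by linear_combination h
  have hq : 1 < (x : ℝ) ^ 2 + x * b + b ^ 2 := by
    have hb2 : 0 < b ^ 2 := by positivity
    have hx1 : (1 : ℝ) ≤ x ^ 2 := by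
      exact_mod_cast Int.one_le_abs (pow_ne_zero 2 hx) |>.trans_eq (abs_of_nonneg (sq_nonneg x))
    have hxb : 0 ≤ x * b := by
      rcases lt_or_gt_of_ne hx with h0 | h0
      · have h0' : (x : ℝ) < 0 := by exact_mod_cast h0
        have : b ^ 3 < 0 := by linarith [Odd.pow_neg (n := 3) (by decide) h0']
        exact mul_nonneg_of_nonpos_of_nonpos h0'.le ((Odd.pow_neg_iff (by decide)).1 this).le
      · have h0' : (1 : ℝ) ≤ x := by exact_mod_cast h0
        have : 0 ≤ b ^ 3 := by linarith [one_le_pow₀ h0' (n := 3)]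
        exact mul_nonneg (by linarith) ((Odd.pow_nonneg_iff (by decide)).1 this)
    linarith
  have hpos : 0 < (x : ℝ) - b := by
    by_contra! hneg
    nlinarith
  exact ⟨hpos, by nlinarith⟩

theorem exists_unit_eq_binomial {K : Type*} [Field K] [NumberField K] {θ : K} {d x y : ℤ}
    (hθ : θ ^ 3 = d) (hxy : x ^ 3 - d * y ^ 3 = 1) :
    ∃ u : (𝓞 K)ˣ, algebraMap (𝓞 K) K u = x - y * θ := by
  have hint : IsIntegral ℤ θ := IsIntegral.of_pow (n := 3) (by norm_num) <| by
    rw [hθ]; exact isIntegral_algebraMap (x := d)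
  obtain ⟨t, rfl⟩ : ∃ t : 𝓞 K, algebraMap (𝓞 K) K t = θ := ⟨⟨θ, hint⟩, rfl⟩
  have ht : t ^ 3 = d := FaithfulSMul.algebraMap_injective (𝓞 K) K (by
    rw [map_pow, map_intCast, hθ])
  have hK : (x : 𝓞 K) ^ 3 - d * y ^ 3 = 1 := by
    simpa using congrArg (Int.cast : ℤ → 𝓞 K) hxy
  have hmul : ((x : 𝓞 K) - y * t) * (x ^ 2 + x * y * t + y ^ 2 * t ^ 2) = 1 := by
    linear_combination hK - (y : 𝓞 K) ^ 3 * ht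
  exact ⟨Units.mkOfMulEqOne _ _ hmul, by simp⟩

section NotCube

variable {d : ℤ} {r : ℝ}

theorem exists_binomial_pow_eq (hd : ∀ b : ℚ, b ^ 3 ≠ d) (hr : r ^ 3 = d) {x y x' y' : ℤ}
    (hxy : x ^ 3 - d * y ^ 3 = 1) (hx : x ≠ 0) (hy : y ≠ 0)
    (hxy' : x' ^ 3 - d * y' ^ 3 = 1) (hx' : x' ≠ 0) (hy' : y' ≠ 0) :
    ∃ m n : ℕ, m ≠ 0 ∧ n ≠ 0 ∧ (x - y * r) ^ m = (x' - y' * r) ^ n := by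
  have hirr : Irreducible (X ^ 3 - C (d : ℚ)) :=
    X_pow_sub_C_irreducible_of_prime Nat.prime_three hd
  have : Fact (Irreducible (X ^ 3 - C (d : ℚ))) := ⟨hirr⟩
  have : NumberField (AdjoinRoot (X ^ 3 - C (d : ℚ))) :=
    { to_charZero := charZero_of_injective_algebraMap
        (algebraMap ℚ (AdjoinRoot (X ^ 3 - C (d : ℚ)))).injective
      to_finiteDimensional := (AdjoinRoot.powerBasis hirr.ne_zero).finite }
  let φ : AdjoinRoot (X ^ 3 - C (d : ℚ)) →+* ℝ :=
    AdjoinRoot.lift (algebraMap ℚ ℝ) r (by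
      rw [eval₂_sub, eval₂_C, eval₂_X_pow, hr, eq_ratCast, Rat.cast_intCast, sub_self])
  have hφ : φ (AdjoinRoot.root _) = r := AdjoinRoot.lift_root _
  have hθ : (AdjoinRoot.root (X ^ 3 - C (d : ℚ))) ^ 3 = (d : AdjoinRoot (X ^ 3 - C (d : ℚ))) :=
    φ.injective (by rw [map_pow, hφ, hr, map_intCast])
  have hr0 : r ≠ 0 := by
    rintro rfl
    refine hd 0 ?_
    rw [zero_pow (by norm_num)] at hr ⊢
    exact_mod_cast hr
  obtain ⟨u, hu⟩ := exists_unit_eq_binomial hθ hxy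
  obtain ⟨v, hv⟩ := exists_unit_eq_binomial hθ hxy'
  have hu' : φ u = x - y * r := by rw [hu]; simp [hφ]
  have hv' : φ v = x' - y' * r := by rw [hv]; simp [hφ]
  rw [← hu', ← hv']
  obtain ⟨h1, h2⟩ := binomial_pos_lt_one hr hr0 hxy hx hy
  obtain ⟨h3, h4⟩ := binomial_pos_lt_one hr hr0 hxy' hx' hy'
  exact exists_pow_eq_pow_of_rank_eq_one rank_units_adjoinRoot_cubic φ u v
    (hu' ▸ h1) (hu' ▸ h2) (hv' ▸ h3) (hv' ▸ h4)

theorem dvd_of_aeval_cube_root_eq_zero (hd : ∀ b : ℚ, b ^ 3 ≠ d) (hr : r ^ 3 = d) {p : ℤ[X]}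
    (hp : aeval r p = 0) : X ^ 3 - C d ∣ p := by
  have hirr : Irreducible (X ^ 3 - C (d : ℚ)) :=
    X_pow_sub_C_irreducible_of_prime Nat.prime_three hd
  have hmin : minpoly ℚ r = X ^ 3 - C (d : ℚ) :=
    (minpoly.eq_of_irreducible_of_monic hirr (by simp [hr])
      (monic_X_pow_sub_C _ (by norm_num))).symm
  have h : minpoly ℚ r ∣ p.map (algebraMap ℤ ℚ) :=
    minpoly.dvd _ _ (by rwa [aeval_map_algebraMap])
  rw [hmin] at h
  rw [← map_dvd_map (algebraMap ℤ ℚ) (RingHom.injective_int _)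
    (monic_X_pow_sub_C _ (by norm_num))]
  simpa using h

theorem exponents_eq_of_binomial_pow_eq_real (hd : ∀ b : ℚ, b ^ 3 ≠ d) (hr : r ^ 3 = d)
    {x y x' y' : ℤ} (hxy : x ^ 3 - d * y ^ 3 = 1) (hx : x ≠ 0) (hy : y ≠ 0)
    (hxy' : x' ^ 3 - d * y' ^ 3 = 1) {m n : ℕ} (hm : m ≠ 0) (hn : ¬ 3 ∣ n)
    (h : (x - y * r) ^ m = (x' - y' * r) ^ n) : m = n := by
  have hmonic : (X ^ 3 - C d : ℤ[X]).Monic := monic_X_pow_sub_C _ (by norm_num)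
  have hdeg : (X ^ 3 - C d : ℤ[X]).degree = 3 := degree_X_pow_sub_C (by norm_num) _
  let c : AdjoinRoot (X ^ 3 - C d : ℤ[X]) →+ ℤ :=
    ((lcoeff ℤ 2).comp (AdjoinRoot.modByMonicHom hmonic)).toAddMonoidHom
  have hc (p : ℤ[X]) (hp : p.degree < 3) : c (AdjoinRoot.mk _ p) = p.coeff 2 := by
    have : p %ₘ (X ^ 3 - C d) = p := (modByMonic_eq_self_iff hmonic).2 (by rwa [hdeg])
    change (p %ₘ (X ^ 3 - C d)).coeff 2 = _
    rw [this]
  have hθ : (AdjoinRoot.root (X ^ 3 - C d : ℤ[X])) ^ 3 = d := by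
    have := AdjoinRoot.mk_self (f := (X ^ 3 - C d : ℤ[X]))
    simpa [sub_eq_zero] using this
  refine exponents_eq_of_binomial_pow_eq c hθ ?_ ?_ ?_ hxy hx hy hxy' hm hn ?_
  · rw [← map_one (AdjoinRoot.mk _), hc _ (by rw [degree_one]; norm_num)]
    simp [coeff_one]
  · rw [← AdjoinRoot.mk_X, hc _ (by rw [degree_X]; norm_num)]
    simp [coeff_X]
  · rw [← AdjoinRoot.mk_X, ← map_pow, hc _ (by rw [degree_X_pow]; norm_num)]
    simp
  · have hdvd : X ^ 3 - C d ∣ (C x - C y * X) ^ m - (C x' - C y' * X) ^ n :=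
      dvd_of_aeval_cube_root_eq_zero hd hr (by simp [h])
    simpa using AdjoinRoot.mk_eq_mk.2 hdvd

theorem eq_of_binomial_eq (hd : ∀ b : ℚ, b ^ 3 ≠ d) (hr : r ^ 3 = d) {x y x' y' : ℤ}
    (h : x - y * r = x' - y' * r) : (x, y) = (x', y') := by
  have hy : y = y' := by
    by_contra hne
    have hne' : (y - y' : ℚ) ≠ 0 := sub_ne_zero.2 (by exact_mod_cast hne)
    refine hd ((x - x') / (y - y')) ?_
    rw [div_pow, div_eq_iff (pow_ne_zero 3 hne')]
    have : ((x : ℝ) - x') ^ 3 = d * (y - y') ^ 3 := by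
      rw [← hr, ← mul_pow]
      congr 1
      linear_combination h
    exact_mod_cast this
  subst hy
  have hx : (x : ℝ) = x' := by linarith
  rw [Int.cast_injective hx]

theorem nontrivial_solution_unique (hd : ∀ b : ℚ, b ^ 3 ≠ d) {x y x' y' : ℤ}
    (hxy : x ^ 3 - d * y ^ 3 = 1) (hx : x ≠ 0) (hy : y ≠ 0)
    (hxy' : x' ^ 3 - d * y' ^ 3 = 1) (hx' : x' ≠ 0) (hy' : y' ≠ 0) : (x, y) = (x', y') := by
  obtain ⟨r, hr⟩ := exists_real_cube_root d
  have hr0 : r ≠ 0 := by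
    rintro rfl
    refine hd 0 ?_
    rw [zero_pow (by norm_num)] at hr ⊢
    exact_mod_cast hr
  have hpos := (binomial_pos_lt_one hr hr0 hxy hx hy).1
  have hpos' := (binomial_pos_lt_one hr hr0 hxy' hx' hy').1
  obtain ⟨m, n, hm, hn, h⟩ := exists_binomial_pow_eq hd hr hxy hx hy hxy' hx' hy'
  obtain ⟨g, m, n, hg, hcop, rfl, rfl⟩ := Nat.exists_coprime' (Nat.gcd_pos_of_pos_left n hm.bot_lt)
  have hm0 : m ≠ 0 := left_ne_zero_of_mul hm
  have hn0 : n ≠ 0 := left_ne_zero_of_mul hn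
  rw [pow_mul, pow_mul] at h
  replace h := (pow_left_inj₀ (by positivity) (by positivity) hg.ne').1 h
  have hmn : m = n := by
    by_cases h3 : 3 ∣ n
    · have h3' : ¬ 3 ∣ m := fun h3' ↦ Nat.not_coprime_of_dvd_of_dvd (by norm_num) h3' h3 hcop
      exact (exponents_eq_of_binomial_pow_eq_real hd hr hxy' hx' hy' hxy hn0 h3' h.symm).symm
    · exact exponents_eq_of_binomial_pow_eq_real hd hr hxy hx hy hxy' hm0 h3 h
  subst hmn
  exact eq_of_binomial_eq hd hr ((pow_left_inj₀ hpos.le hpos'.le hm0).1 h)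

end NotCube

theorem eq_of_cube_sub_cube_eq_one {x y : ℤ} (h : x ^ 3 - y ^ 3 = 1) :
    (x, y) = (1, 0) ∨ (x, y) = (0, -1) := by
  have hfac : (x - y) * (x ^ 2 + x * y + y ^ 2) = 1 := by linear_combination h
  have hq : 0 ≤ x ^ 2 + x * y + y ^ 2 := by nlinarith [sq_nonneg (x + y), sq_nonneg x, sq_nonneg y]
  obtain ⟨h1, -⟩ | ⟨-, h2⟩ := Int.mul_eq_one_iff_eq_one_or_neg_one.1 hfac
  · obtain rfl : x = y + 1 := by linarith
    have : y * (y + 1) = 0 := by linarith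
    obtain rfl | h0 := mul_eq_zero.1 this
    · left; rfl
    · right
      obtain rfl : y = -1 := by linarith
      rfl
  · omega

/-- A cube-free integer that is a rational cube is `1` or `-1`. -/
theorem eq_one_or_neg_one_of_cubefree_of_cube {d : ℤ}
    (hd : ∀ p : ℕ, p.Prime → ¬ ((p : ℤ) ^ 3 ∣ d)) {b : ℚ} (hb : b ^ 3 = d) : d = 1 ∨ d = -1 := by
  obtain ⟨k, rfl⟩ := IsIntegrallyClosed.exists_algebraMap_eq_of_isIntegral_pow (R := ℤ) (n := 3)
    (by norm_num) (by rw [hb]; exact isIntegral_algebraMap (x := d))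
  have hk : k ^ 3 = d := by
    rw [eq_intCast] at hb
    exact_mod_cast hb
  have hk1 : k.natAbs = 1 := by
    by_contra hne
    obtain ⟨p, hp, hpk⟩ := Nat.exists_prime_and_dvd hne
    exact hd p hp (hk ▸ pow_dvd_pow_of_dvd (Int.natCast_dvd.2 hpk) 3)
  obtain rfl | rfl := Int.natAbs_eq_iff.1 hk1 <;> simp [← hk]

/-- **Theorem (Delone).** Let `d` be a cube-free integer (no cube of a prime divides `d`).
The equation `x^3 - d*y^3 = 1` has at most 2 integral solutions. -/
theorem delone_cubefree_at_most_two (d : ℤ)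
    (hd : ∀ p : ℕ, p.Prime → ¬ ((p : ℤ) ^ 3 ∣ d)) :
    {q : ℤ × ℤ | q.1 ^ 3 - d * q.2 ^ 3 = 1}.Finite ∧
      {q : ℤ × ℤ | q.1 ^ 3 - d * q.2 ^ 3 = 1}.ncard ≤ 2 := by
  suffices h : ∃ a b : ℤ × ℤ, {q : ℤ × ℤ | q.1 ^ 3 - d * q.2 ^ 3 = 1} ⊆ {a, b} by
    obtain ⟨a, b, hab⟩ := h
    exact ⟨(Set.toFinite {a, b}).subset hab,
      (Set.ncard_le_ncard hab).trans ((Set.ncard_insert_le a {b}).trans (by simp))⟩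
  by_cases hcube : ∃ b : ℚ, b ^ 3 = d
  · obtain ⟨b, hb⟩ := hcube
    obtain rfl | rfl := eq_one_or_neg_one_of_cubefree_of_cube hd hb
    · refine ⟨(1, 0), (0, -1), fun ⟨x, y⟩ hxy ↦ ?_⟩
      exact eq_of_cube_sub_cube_eq_one (by simpa using hxy)
    · refine ⟨(1, 0), (0, 1), fun ⟨x, y⟩ hxy ↦ ?_⟩
      have := eq_of_cube_sub_cube_eq_one (x := x) (y := -y)
        (by rw [Set.mem_ofPred_eq] at hxy; linear_combination hxy)
      simpa [neg_eq_iff_eq_neg] using this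
  · push Not at hcube
    have htriv {x y : ℤ} (hxy : x ^ 3 - d * y ^ 3 = 1) (hne : (x, y) ≠ (1, 0)) :
        x ≠ 0 ∧ y ≠ 0 := by
      constructor
      · rintro rfl
        have hu : d * (-y ^ 3) = 1 := by linear_combination hxy
        obtain h | h := Int.isUnit_iff.1 (IsUnit.of_mul_eq_one _ hu)
        · exact hcube 1 (by simp [h])
        · exact hcube (-1) (by rw [h]; norm_num)
      · rintro rfl
        have h := eq_of_cube_sub_cube_eq_one (x := x) (y := 0) (by linear_combination hxy)
        simp_all
    by_cases hex : ∃ q : ℤ × ℤ, q.1 ^ 3 - d * q.2 ^ 3 = 1 ∧ q ≠ (1, 0)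
    · obtain ⟨⟨x, y⟩, hxy, hne⟩ := hex
      obtain ⟨hx, hy⟩ := htriv hxy hne
      refine ⟨(1, 0), (x, y), fun ⟨x', y'⟩ hxy' ↦ ?_⟩
      by_cases hne' : (x', y') = (1, 0)
      · exact Or.inl hne'
      · obtain ⟨hx', hy'⟩ := htriv hxy' hne'
        exact Or.inr (nontrivial_solution_unique hcube hxy' hx' hy' hxy hx hy)
    · push Not at hex
      exact ⟨(1, 0), (1, 0), fun q hq ↦ Or.inl (hex q hq)⟩
end

section
/- Let F(x,y) = a*x^3 + b*x^2*y + c*x*y^2 + d*y^3 be a binary cubic form with integer coefficients a, b, c, d, which is irreducible in the sense that F does not factor as a product of two nonconstant homogeneous polynomials with rational coefficients, and whose discriminant D = 18*a*b*c*d - 4*b^3*d + b^2*c^2 - 4*a*c^3 - 27*a^2*d^2 is negative. Then the number of integer pairs (m, n) with F(m, n) = 1 is at most 5. -/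
open MvPolynomial

/-- The binary cubic form `a*x^3 + b*x^2*y + c*x*y^2 + d*y^3`, viewed as a polynomial in two
variables over `ℚ`. -/
noncomputable def cubicForm (a b c d : ℤ) : MvPolynomial (Fin 2) ℚ :=
  C (a : ℚ) * X 0 ^ 3 + C (b : ℚ) * X 0 ^ 2 * X 1 + C (c : ℚ) * X 0 * X 1 ^ 2 +
    C (d : ℚ) * X 1 ^ 3

/-- The integer combination `A + B τ + C τ²`. -/
def quadComb {R : Type*} [CommRing R] (τ : R) (A B C : ℤ) : R := A + B * τ + C * τ ^ 2

lemma quadComb_mul {R : Type*} [CommRing R] {τ : R} {p q r : ℤ}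
    (hτ : τ ^ 3 = p * τ ^ 2 + q * τ + r) (A B C A' B' C' : ℤ) :
    quadComb τ A B C * quadComb τ A' B' C' =
      quadComb τ (A * A' + r * (B * C' + C * B') + p * r * (C * C'))
        (A * B' + A' * B + q * (B * C' + C * B') + (p * q + r) * (C * C'))
        (A * C' + A' * C + B * B' + p * (B * C' + C * B') + (p ^ 2 + q) * (C * C')) := by
  simp only [quadComb]
  push_cast
  linear_combination ((B : R) * C' + C * B' + C * C' * (τ + p)) * hτ

lemma quadComb_inj {R : Type*} [CommRing R] {τ : R}
    (hind : ∀ A B C : ℤ, quadComb τ A B C = 0 → A = 0 ∧ B = 0 ∧ C = 0)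
    {A B C A' B' C' : ℤ} (h : quadComb τ A B C = quadComb τ A' B' C') :
    A = A' ∧ B = B' ∧ C = C' := by
  have := hind (A - A') (B - B') (C - C') (by
    simp only [quadComb] at h ⊢
    push_cast
    linear_combination h)
  omega

lemma Int.exists_eq_two_pow_mul_odd {n : ℤ} (hn : n ≠ 0) :
    ∃ (k : ℕ) (m : ℤ), Odd m ∧ n = 2 ^ k * m := by
  obtain ⟨k, m, hm, h⟩ := Nat.exists_eq_two_pow_mul_odd (Int.natAbs_ne_zero.mpr hn)
  rcases Int.natAbs_eq n with h' | h'
  · exact ⟨k, m, by exact_mod_cast hm, by rw [h', h]; push_cast; ring⟩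
  · exact ⟨k, -m, by simpa using hm, by rw [h', h]; push_cast; ring⟩

lemma two_pow_mul_odd_le {m n : ℕ} {a b : ℤ} (ha : Odd a) (h : 2 ^ m * a = 2 ^ n * b) : n ≤ m := by
  by_contra! hlt
  obtain ⟨j, rfl⟩ := Nat.exists_eq_add_of_lt hlt
  have : a = 2 * (2 ^ j * b) := by
    apply mul_left_cancel₀ (pow_ne_zero m (two_ne_zero' ℤ))
    rw [h]; ring
  exact (Int.not_even_iff_odd.mpr ha) (this ▸ even_two_mul _)

lemma two_pow_mul_odd_inj {m n : ℕ} {a b : ℤ} (ha : Odd a) (hb : Odd b)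
    (h : 2 ^ m * a = 2 ^ n * b) : m = n :=
  le_antisymm (two_pow_mul_odd_le hb h.symm) (two_pow_mul_odd_le ha h)

/-- Elements `A + 2 ^ (σ + k + 2) B τ + 2 ^ (2 * σ + k + 2) C τ²` with `A`, `B`, `C` odd. -/
def HasSlope {R : Type*} [CommRing R] (τ : R) (σ k : ℕ) (u : R) : Prop :=
  ∃ A B C : ℤ, Odd A ∧ Odd B ∧ Odd C ∧
    u = quadComb τ A (4 * 2 ^ σ * 2 ^ k * B) (4 * (2 ^ σ) ^ 2 * 2 ^ k * C)

/-- Elements `A + 2 ^ (σ + k + 2) B τ + 2 ^ (2 * σ + k + 2) C τ²` with `A` odd. -/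
def HasSlopeLevel {R : Type*} [CommRing R] (τ : R) (σ k : ℕ) (u : R) : Prop :=
  ∃ A B C : ℤ, Odd A ∧
    u = quadComb τ A (4 * 2 ^ σ * 2 ^ k * B) (4 * (2 ^ σ) ^ 2 * 2 ^ k * C)

section Slope

variable {R : Type*} [CommRing R] {τ : R} {p q r : ℤ}

lemma HasSlope.level {σ k : ℕ} {u : R} (h : HasSlope τ σ k u) : HasSlopeLevel τ σ k u := by
  obtain ⟨A, B, C, hA, -, -, h⟩ := h
  exact ⟨A, B, C, hA, h⟩

lemma hasSlopeLevel_one (σ k : ℕ) : HasSlopeLevel τ σ k 1 :=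
  ⟨1, 0, 0, odd_one, by simp [quadComb]⟩

lemma HasSlopeLevel.mul (hτ : τ ^ 3 = p * τ ^ 2 + q * τ + r) {σ k : ℕ} {u w : R}
    (hu : HasSlopeLevel τ σ k u) (hw : HasSlopeLevel τ σ k w) : HasSlopeLevel τ σ k (u * w) := by
  obtain ⟨A, B, C, hA, rfl⟩ := hu
  obtain ⟨A', B', C', hA', rfl⟩ := hw
  rw [quadComb_mul hτ]
  unfold HasSlopeLevel
  generalize (2 : ℤ) ^ σ = S
  generalize (2 : ℤ) ^ k = K
  refine ⟨A * A' + 2 * (8 * S ^ 3 * K ^ 2 * r * (B * C' + C * B') +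
      8 * p * r * S ^ 4 * K ^ 2 * (C * C')),
    A * B' + A' * B + 4 * q * S ^ 2 * K * (B * C' + C * B') +
      4 * (p * q + r) * S ^ 3 * K * (C * C'),
    A * C' + A' * C + 4 * K * B * B' + 4 * p * S * K * (B * C' + C * B')
      + 4 * (p ^ 2 + q) * S ^ 2 * K * (C * C'),
    (hA.mul hA').add_even (even_two_mul _), ?_⟩
  congr 1 <;> ring

lemma HasSlope.mul_level (hτ : τ ^ 3 = p * τ ^ 2 + q * τ + r) {σ k : ℕ} {u w : R}
    (hu : HasSlope τ σ k u) (hw : HasSlopeLevel τ σ (k + 1) w) : HasSlope τ σ k (u * w) := by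
  obtain ⟨A, B, C, hA, hB, hC, rfl⟩ := hu
  obtain ⟨A', B', C', hA', rfl⟩ := hw
  rw [quadComb_mul hτ, pow_succ 2 k]
  unfold HasSlope
  generalize (2 : ℤ) ^ σ = S
  generalize (2 : ℤ) ^ k = K
  refine ⟨A * A' + 2 * (16 * S ^ 3 * K ^ 2 * r * (B * C' + C * B') +
      16 * p * r * S ^ 4 * K ^ 2 * (C * C')),
    A' * B + 2 * (A * B' + 4 * q * S ^ 2 * K * (B * C' + C * B')
      + 4 * (p * q + r) * S ^ 3 * K * (C * C')),
    A' * C + 2 * (A * C' + 4 * K * B * B' + 4 * p * S * K * (B * C' + C * B')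
      + 4 * (p ^ 2 + q) * S ^ 2 * K * (C * C')),
    (hA.mul hA').add_even (even_two_mul _), (hA'.mul hB).add_even (even_two_mul _),
    (hA'.mul hC).add_even (even_two_mul _), ?_⟩
  congr 1 <;> ring

lemma HasSlope.sq (hτ : τ ^ 3 = p * τ ^ 2 + q * τ + r) {σ k : ℕ} {u : R}
    (hu : HasSlope τ σ k u) : HasSlope τ σ (k + 1) (u ^ 2) := by
  obtain ⟨A, B, C, hA, hB, hC, rfl⟩ := hu
  unfold HasSlope
  rw [pow_two (quadComb _ _ _ _), quadComb_mul hτ, pow_succ 2 k]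
  generalize (2 : ℤ) ^ σ = S
  generalize (2 : ℤ) ^ k = K
  refine ⟨A * A + 2 * (16 * S ^ 3 * K ^ 2 * r * B * C + 8 * p * r * S ^ 4 * K ^ 2 * C ^ 2),
    A * B + 2 * (2 * q * S ^ 2 * K * B * C + (p * q + r) * S ^ 3 * K * C ^ 2),
    A * C + 2 * (K * B ^ 2 + 2 * p * S * K * B * C + (p ^ 2 + q) * S ^ 2 * K * C ^ 2),
    (hA.mul hA).add_even (even_two_mul _), (hA.mul hB).add_even (even_two_mul _),
    (hA.mul hC).add_even (even_two_mul _), ?_⟩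
  congr 1 <;> ring

lemma HasSlopeLevel.pow (hτ : τ ^ 3 = p * τ ^ 2 + q * τ + r) {σ k : ℕ} {u : R}
    (hu : HasSlopeLevel τ σ k u) (n : ℕ) : HasSlopeLevel τ σ k (u ^ n) := by
  induction n with
  | zero => simpa using hasSlopeLevel_one σ k
  | succ n ih => rw [pow_succ]; exact ih.mul hτ hu

lemma HasSlope.pow (hτ : τ ^ 3 = p * τ ^ 2 + q * τ + r) {σ : ℕ} {n : ℕ} (hn : 0 < n) {k : ℕ} {u : R}
    (hu : HasSlope τ σ k u) : ∃ k', HasSlope τ σ k' (u ^ n) := by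
  induction n using Nat.strong_induction_on generalizing k u with
  | _ n ih =>
    obtain ⟨m, rfl | rfl⟩ := Nat.even_or_odd' n
    · rw [pow_mul]
      exact ih m (by omega) (by omega) (hu.sq hτ)
    · rw [pow_succ', pow_mul]
      exact ⟨k, hu.mul_level hτ ((hu.sq hτ).level.pow hτ m)⟩

lemma hasSlope_sq_of_linear {σ : ℕ} {A D : ℤ} (hA : Odd A) (hD : Odd D) :
    HasSlope τ σ 0 ((A + (2 ^ (σ + 1) * D : ℤ) * τ : R) ^ 2) := by
  refine ⟨A * A, A * D, D * D, hA.mul hA, hA.mul hD, hD.mul hD, ?_⟩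
  simp only [quadComb]
  push_cast
  ring

lemma HasSlope.ne_one (hind : ∀ A B C : ℤ, quadComb τ A B C = 0 → A = 0 ∧ B = 0 ∧ C = 0)
    {σ k : ℕ} {u : R} (hu : HasSlope τ σ k u) : u ≠ 1 := by
  obtain ⟨A, B, C, hA, hB, hC, rfl⟩ := hu
  intro h
  have h1 : quadComb τ A (4 * 2 ^ σ * 2 ^ k * B) (4 * (2 ^ σ) ^ 2 * 2 ^ k * C)
    = quadComb τ 1 0 0 := by rw [h]; simp [quadComb]
  have := (quadComb_inj hind h1).2.1
  have hB0 : B ≠ 0 := by rintro rfl; simp at hB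
  simp [hB0] at this

lemma HasSlope.eq_of_eq (hind : ∀ A B C : ℤ, quadComb τ A B C = 0 → A = 0 ∧ B = 0 ∧ C = 0)
    {σ k σ' k' : ℕ} {u : R} (hu : HasSlope τ σ k u) (hu' : HasSlope τ σ' k' u) : σ = σ' := by
  obtain ⟨A, B, C, hA, hB, hC, rfl⟩ := hu
  obtain ⟨A', B', C', hA', hB', hC', h⟩ := hu'
  obtain ⟨-, h1, h2⟩ := quadComb_inj hind h
  have e1 : σ + k = σ' + k' := two_pow_mul_odd_inj hB hB' (by rw [pow_add, pow_add]; linarith)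
  have e2 : 2 * σ + k = 2 * σ' + k' :=
    two_pow_mul_odd_inj hC hC' (by
      rw [pow_add, pow_add, mul_comm 2, mul_comm 2, pow_mul, pow_mul]; linarith)
  omega

lemma HasSlope.eq_of_mul_eq_one (hτ : τ ^ 3 = p * τ ^ 2 + q * τ + r)
    (hind : ∀ A B C : ℤ, quadComb τ A B C = 0 → A = 0 ∧ B = 0 ∧ C = 0)
    {σ k σ' k' : ℕ} {u w : R} (hu : HasSlope τ σ k u) (hw : HasSlope τ σ' k' w)
    (h : u * w = 1) : σ = σ' := by
  obtain ⟨A, B, C, hA, hB, hC, rfl⟩ := hu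
  obtain ⟨A', B', C', hA', hB', hC', rfl⟩ := hw
  have h1 : quadComb τ 1 0 0 = 1 := by simp [quadComb]
  rw [quadComb_mul hτ, ← h1] at h
  obtain ⟨-, h1, h2⟩ := quadComb_inj hind h
  have e1 : σ + k = σ' + k' := by
    refine two_pow_mul_odd_inj (hA'.mul hB) (b := -(A * B' + 2 * (2 * 2 ^ σ * 2 ^ k *
      (q * (B * (2 ^ σ' * C') + 2 ^ σ * C * B') + (p * q + r) * (2 ^ σ * C * (2 ^ σ' * C'))))))
      ((hA.mul hB').add_even (even_two_mul _)).neg ?_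
    apply mul_left_cancel₀ (four_ne_zero' ℤ)
    rw [pow_add, pow_add]
    linear_combination h1
  have e2 : (2 : ℤ) ^ σ * 2 ^ k = 2 ^ σ' * 2 ^ k' := by rw [← pow_add, ← pow_add, e1]
  refine two_pow_mul_odd_inj (b := -(A * C')) ((hA'.mul hC).add_even (even_two_mul
    (2 * 2 ^ k * (B * B' + p * (B * (2 ^ σ' * C') + 2 ^ σ * C * B')
      + (p ^ 2 + q) * (2 ^ σ * C * (2 ^ σ' * C')))))) (hA.mul hC').neg ?_
  have hne : (4 * (2 ^ σ * 2 ^ k) : ℤ) ≠ 0 := by positivity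
  apply mul_left_cancel₀ hne
  generalize (2 : ℤ) ^ σ = S at *
  generalize (2 : ℤ) ^ k = K at *
  generalize (2 : ℤ) ^ σ' = S' at *
  generalize (2 : ℤ) ^ k' = K' at *
  linear_combination h2 + (4 * A * C' * S' + 16 * S * K * (B * B' + p * (B * (S' * C') + S * C * B')
      + (p ^ 2 + q) * (S * C * (S' * C')))) * e2

end Slope

/-- The binary cubic form `x³ + b x² y + c x y² + d y³`. -/
def monicForm (b c d : ℤ) (P : ℤ × ℤ) : ℤ :=
  P.1 ^ 3 + b * P.1 ^ 2 * P.2 + c * P.1 * P.2 ^ 2 + d * P.2 ^ 3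

/-- The determinant of two integer vectors. -/
def cross (P Q : ℤ × ℤ) : ℤ := P.1 * Q.2 - P.2 * Q.1

/-- Congruence modulo `2` of integer vectors. -/
def CongrTwo (P Q : ℤ × ℤ) : Prop := P.1 % 2 = Q.1 % 2 ∧ P.2 % 2 = Q.2 % 2

/-- The coefficient of `θ` in the square of `pointGen b θ P`. -/
def sqCoeffOne (b c d : ℤ) (P : ℤ × ℤ) : ℤ := 2 * c * P.1 * P.2 + (b * c + d) * P.2 ^ 2

/-- The coefficient of `θ²` in the square of `pointGen b θ P`. -/
def sqCoeffTwo (c : ℤ) (P : ℤ × ℤ) : ℤ := P.1 ^ 2 - c * P.2 ^ 2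

/-- The constant coefficient of the quotient of `Q.1 + Q.2 θ` by `P.1 + P.2 θ`. -/
def ratioConst (b c d : ℤ) (P Q : ℤ × ℤ) : ℤ :=
  Q.1 * (P.1 ^ 2 + b * P.1 * P.2 + c * P.2 ^ 2) + Q.2 * P.2 ^ 2 * d

section Ratio

variable {K : Type*} [CommRing K]

/-- A generator of `ℤ[θ]` attached to a point `P` at which the cubic form takes the value `1`. -/
def pointGen (b : ℤ) (θ : K) (P : ℤ × ℤ) : K := (P.1 + b * P.2) * θ - P.2 * θ ^ 2

/-- The quotient of `Q.1 + Q.2 θ` by `P.1 + P.2 θ`, when the cubic form takes the value `1` at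
`P`. -/
def unitRatio (b c d : ℤ) (θ : K) (P Q : ℤ × ℤ) : K :=
  ratioConst b c d P Q + cross P Q * pointGen b θ P

variable {b c d : ℤ} {θ : K}

lemma mul_unitRatio (hθ : θ ^ 3 = b * θ ^ 2 - c * θ + d) {P : ℤ × ℤ} (hP : monicForm b c d P = 1)
    (Q : ℤ × ℤ) : (P.1 + P.2 * θ) * unitRatio b c d θ P Q = Q.1 + Q.2 * θ := by
  have hP' : (P.1 ^ 3 + b * P.1 ^ 2 * P.2 + c * P.1 * P.2 ^ 2 + d * P.2 ^ 3 : K) = 1 := by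
    exact_mod_cast congrArg (Int.cast : ℤ → K) hP
  simp only [unitRatio, ratioConst, cross, pointGen]
  push_cast
  linear_combination (Q.1 + Q.2 * θ) * hP' - (P.1 * Q.2 - P.2 * Q.1) * P.2 ^ 2 * hθ

lemma pointGen_sq (hθ : θ ^ 3 = b * θ ^ 2 - c * θ + d) (P : ℤ × ℤ) :
    pointGen b θ P ^ 2 = quadComb θ (-2 * d * P.1 * P.2 - b * d * P.2 ^ 2)
      (sqCoeffOne b c d P) (sqCoeffTwo c P) := by
  simp only [pointGen, quadComb, sqCoeffOne, sqCoeffTwo]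
  push_cast
  linear_combination (-2 * (P.1 + b * P.2) * P.2 + P.2 ^ 2 * (θ + b)) * hθ

lemma quadComb_pointGen (hθ : θ ^ 3 = b * θ ^ 2 - c * θ + d) (P : ℤ × ℤ) (A B C : ℤ) :
    quadComb (pointGen b θ P) A B C =
      quadComb θ (A + C * (-2 * d * P.1 * P.2 - b * d * P.2 ^ 2))
        (B * (P.1 + b * P.2) + C * sqCoeffOne b c d P) (-B * P.2 + C * sqCoeffTwo c P) := by
  have := pointGen_sq hθ P
  rw [quadComb, this]
  simp only [pointGen, quadComb, sqCoeffOne, sqCoeffTwo]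
  push_cast
  ring

lemma det_pointGen (P : ℤ × ℤ) :
    (P.1 + b * P.2) * sqCoeffTwo c P + P.2 * sqCoeffOne b c d P = monicForm b c d P := by
  simp only [sqCoeffOne, sqCoeffTwo, monicForm]
  ring

lemma pointGen_cube (hθ : θ ^ 3 = b * θ ^ 2 - c * θ + d) (P : ℤ × ℤ) :
    pointGen b θ P ^ 3 = (b * P.1 + 2 * c * P.2 : ℤ) * pointGen b θ P ^ 2
      + (-(c * P.1 ^ 2 + (b * c + 3 * d) * P.1 * P.2 + (c ^ 2 + b * d) * P.2 ^ 2) : ℤ)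
        * pointGen b θ P
      + (d * ((P.1 + b * P.2) ^ 3 - (P.1 + b * P.2) ^ 2 * P.2 * b + (P.1 + b * P.2) * P.2 ^ 2 * c
        - P.2 ^ 3 * d) : ℤ) := by
  have h2 := pointGen_sq hθ P
  have h4 : θ ^ 4 = (b ^ 2 - c) * θ ^ 2 + (d - b * c) * θ + b * d := by
    linear_combination (θ + b) * hθ
  simp only [pointGen, quadComb, sqCoeffOne, sqCoeffTwo] at h2 ⊢
  push_cast at h2 ⊢
  generalize (P.1 : K) = x at *
  generalize (P.2 : K) = y at *
  linear_combination ((x + b * y) * θ - y * θ ^ 2 - (b * x + 2 * c * y)) * h2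
    + ((x + b * y) * (x ^ 2 - c * y ^ 2) - y * (2 * c * x * y + (b * c + d) * y ^ 2)) * hθ
    - y * (x ^ 2 - c * y ^ 2) * h4

lemma pointGen_indep (hθ : θ ^ 3 = b * θ ^ 2 - c * θ + d)
    (hind : ∀ A B C : ℤ, quadComb θ A B C = 0 → A = 0 ∧ B = 0 ∧ C = 0)
    {P : ℤ × ℤ} (hP : monicForm b c d P = 1) (A B C : ℤ)
    (h : quadComb (pointGen b θ P) A B C = 0) : A = 0 ∧ B = 0 ∧ C = 0 := by
  rw [quadComb_pointGen hθ] at h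
  obtain ⟨h0, h1, h2⟩ := hind _ _ _ h
  rw [← det_pointGen] at hP
  have hC : C = 0 := by
    linear_combination -C * hP + P.2 * h1 + (P.1 + b * P.2) * h2
  have hB : B = 0 := by
    linear_combination -B * hP + sqCoeffTwo c P * h1 - sqCoeffOne b c d P * h2
  subst hC
  simpa [hB] using h0

lemma odd_ratioConst {P Q : ℤ × ℤ} (hP : monicForm b c d P = 1) (h : CongrTwo P Q) :
    Odd (ratioConst b c d P Q) := by
  obtain ⟨h1, h2⟩ := h
  obtain ⟨i, hi⟩ : ∃ i, Q.1 = P.1 + 2 * i := ⟨(Q.1 - P.1) / 2, by omega⟩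
  obtain ⟨j, hj⟩ : ∃ j, Q.2 = P.2 + 2 * j := ⟨(Q.2 - P.2) / 2, by omega⟩
  refine ⟨i * (P.1 ^ 2 + b * P.1 * P.2 + c * P.2 ^ 2) + j * P.2 ^ 2 * d, ?_⟩
  rw [ratioConst, hi, hj]
  rw [monicForm] at hP
  linear_combination hP

lemma even_cross {P Q : ℤ × ℤ} (h : CongrTwo P Q) : Even (cross P Q) := by
  obtain ⟨h1, h2⟩ := h
  obtain ⟨i, hi⟩ : ∃ i, Q.1 = P.1 + 2 * i := ⟨(Q.1 - P.1) / 2, by omega⟩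
  obtain ⟨j, hj⟩ : ∃ j, Q.2 = P.2 + 2 * j := ⟨(Q.2 - P.2) / 2, by omega⟩
  refine ⟨P.1 * j - P.2 * i, ?_⟩
  rw [cross, hi, hj]
  ring

lemma cross_ne_zero {P Q : ℤ × ℤ} (hP : monicForm b c d P = 1) (hQ : monicForm b c d Q = 1)
    (hPQ : P ≠ Q) : cross P Q ≠ 0 := by
  intro h
  obtain ⟨x, y⟩ := P
  obtain ⟨x', y'⟩ := Q
  simp only [monicForm, cross] at hP hQ h
  obtain ⟨A, hA⟩ : ∃ A, A = x' * (x ^ 2 + b * x * y + c * y ^ 2) + y' * y ^ 2 * d := ⟨_, rfl⟩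
  have hx : x' = A * x := by
    rw [hA]; linear_combination -x' * hP - y ^ 2 * d * h
  have hy : y' = A * y := by
    rw [hA]; linear_combination -y' * hP + (x ^ 2 + b * x * y + c * y ^ 2) * h
  have hA3 : A ^ 3 = 1 := by
    rw [hx, hy] at hQ
    linear_combination hQ - A ^ 3 * hP
  have : A = 1 := by
    have : (A - 1) * (A ^ 2 + A + 1) = 0 := by linear_combination hA3
    rcases mul_eq_zero.mp this with h | h
    · linarith
    · nlinarith [sq_nonneg (2 * A + 1)]
  exact hPQ (by simp [hx, hy, this])

/-- The slope of an even power of `unitRatio b c d θ P Q` is determined by the power of `2` dividing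
`cross P Q`. -/
lemma exists_hasSlope_unitRatio (hθ : θ ^ 3 = b * θ ^ 2 - c * θ + d) {P Q : ℤ × ℤ}
    (hP : monicForm b c d P = 1) (hQ : monicForm b c d Q = 1) (hPQ : P ≠ Q) (h : CongrTwo P Q) :
    ∃ (σ : ℕ) (D : ℤ), Odd D ∧ cross P Q = 2 ^ (σ + 1) * D ∧
      ∀ n, 0 < n → ∃ k, HasSlope (pointGen b θ P) σ k (unitRatio b c d θ P Q ^ (2 * n)) := by
  obtain ⟨s, D, hD, hs⟩ := Int.exists_eq_two_pow_mul_odd (cross_ne_zero hP hQ hPQ)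
  obtain _ | σ := s
  · have := even_cross h
    rw [hs, pow_zero, one_mul] at this
    exact absurd hD (Int.not_odd_iff_even.mpr this)
  · refine ⟨σ, D, hD, hs, fun n hn => ?_⟩
    rw [pow_mul, unitRatio, hs]
    exact (hasSlope_sq_of_linear (odd_ratioConst hP h) hD).pow (pointGen_cube hθ P) hn

end Ratio

/-- Powers of units of `ℤ[θ]` seen to first order at `2`: elements
`A + 2 ^ (t + 1) (β θ + γ θ²)` with `A` odd and `(β, γ)` nonzero modulo `2` and different
from `(v₁, v₂)`. -/
def HasDirection {R : Type*} [CommRing R] (θ : R) (v₁ v₂ : ℤ) (u : R) : Prop :=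
  ∃ (A β γ : ℤ) (t : ℕ), Odd A ∧ Odd (β * v₂ - γ * v₁) ∧
    u = quadComb θ A (2 ^ (t + 1) * β) (2 ^ (t + 1) * γ)

lemma HasSlope.hasDirection {R : Type*} [CommRing R] {b c d : ℤ} {θ : R}
    (hθ : θ ^ 3 = b * θ ^ 2 - c * θ + d) {P : ℤ × ℤ} (hP : monicForm b c d P = 1) {σ k : ℕ} {u : R}
    (hu : HasSlope (pointGen b θ P) σ k u) :
    HasDirection θ (sqCoeffOne b c d P) (sqCoeffTwo c P) u := by
  obtain ⟨A, B, C, hA, hB, hC, rfl⟩ := hu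
  rw [← det_pointGen] at hP
  refine ⟨A + 2 * (2 * (2 ^ σ) ^ 2 * 2 ^ k * C * (-2 * d * P.1 * P.2 - b * d * P.2 ^ 2)),
    B * (P.1 + b * P.2) + 2 ^ σ * C * sqCoeffOne b c d P, -B * P.2 + 2 ^ σ * C * sqCoeffTwo c P,
    σ + k + 1, hA.add_even (even_two_mul _), ?_, ?_⟩
  · convert hB using 1
    linear_combination B * hP
  · rw [quadComb_pointGen hθ]
    congr 1 <;> ring

lemma le_of_two_pow_relation {t t' : ℕ} {a a' β γ β' γ' X Y v₁ v₂ : ℤ} (ha : Odd a)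
    (hβ : a * (2 ^ (t + 1) * β) + a' * (2 ^ (t' + 1) * β') + 2 ^ (t + 1) * 2 ^ (t' + 1) * X = 0)
    (hγ : a * (2 ^ (t + 1) * γ) + a' * (2 ^ (t' + 1) * γ') + 2 ^ (t + 1) * 2 ^ (t' + 1) * Y = 0)
    (hv : Odd (β * v₂ - γ * v₁)) : t' ≤ t := by
  have := two_pow_mul_odd_le (m := t) (n := t')
    (b := -(a' * (β' * v₂ - γ' * v₁)) - 2 ^ (t + 1) * (X * v₂ - Y * v₁)) (ha.mul hv) (by
      apply mul_left_cancel₀ (two_ne_zero' ℤ)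
      rw [pow_succ] at *
      rw [pow_succ] at *
      linear_combination v₂ * hβ - v₁ * hγ)
  exact this

lemma odd_of_two_pow_relation {t t' : ℕ} {a a' β γ β' γ' X Y v₁ v₂ w₁ w₂ : ℤ} (ha : Odd a)
    (ha' : Odd a')
    (hβ : a * (2 ^ (t + 1) * β) + a' * (2 ^ (t' + 1) * β') + 2 ^ (t + 1) * 2 ^ (t' + 1) * X = 0)
    (hγ : a * (2 ^ (t + 1) * γ) + a' * (2 ^ (t' + 1) * γ') + 2 ^ (t + 1) * 2 ^ (t' + 1) * Y = 0)
    (hv : Odd (β * v₂ - γ * v₁)) (hw : Odd (β' * w₂ - γ' * w₁)) : Odd (β * w₂ - γ * w₁) := by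
  obtain rfl : t = t' := le_antisymm
    (le_of_two_pow_relation ha' (β := β') (γ := γ') (β' := β) (γ' := γ) (a' := a)
      (X := X) (Y := Y) (by linarith) (by linarith) hw)
    (le_of_two_pow_relation ha hβ hγ hv)
  have h : a * (β * w₂ - γ * w₁) + a' * (β' * w₂ - γ' * w₁)
      + 2 * (2 ^ t * (X * w₂ - Y * w₁)) = 0 := by
    apply mul_left_cancel₀ (pow_ne_zero (t + 1) (two_ne_zero' ℤ))
    linear_combination w₂ * hβ - w₁ * hγ
  have h' : a * (β * w₂ - γ * w₁) = -(a' * (β' * w₂ - γ' * w₁))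
      + 2 * -(2 ^ t * (X * w₂ - Y * w₁)) := by linear_combination h
  have : Odd (a * (β * w₂ - γ * w₁)) := h' ▸ (ha'.mul hw).neg.add_even (even_two_mul _)
  exact (Int.odd_mul.mp this).2

lemma HasDirection.transfer {R : Type*} [CommRing R] {θ : R} {p q r : ℤ}
    (hθ : θ ^ 3 = p * θ ^ 2 + q * θ + r)
    (hind : ∀ A B C : ℤ, quadComb θ A B C = 0 → A = 0 ∧ B = 0 ∧ C = 0) {v₁ v₂ w₁ w₂ : ℤ} {u w : R}
    {A β γ : ℤ} {t : ℕ} (hA : Odd A) (hv : Odd (β * v₂ - γ * v₁))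
    (hu : u = quadComb θ A (2 ^ (t + 1) * β) (2 ^ (t + 1) * γ))
    (hw : HasDirection θ w₁ w₂ w) (huw : u = w ∨ u * w = 1) : Odd (β * w₂ - γ * w₁) := by
  obtain ⟨A', β', γ', t', hA', hw', rfl⟩ := hw
  rw [hu] at huw
  rcases huw with h | h
  · obtain ⟨-, h1, h2⟩ := quadComb_inj hind h
    exact odd_of_two_pow_relation (t := t) (t' := t') (a := 1) (a' := -1) (X := 0) (Y := 0)
      odd_one (by decide)
      (by linear_combination h1) (by linear_combination h2) hv hw'
  · have h1 : quadComb θ 1 0 0 = 1 := by simp [quadComb]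
    rw [quadComb_mul hθ, ← h1] at h
    obtain ⟨-, h1, h2⟩ := quadComb_inj hind h
    exact odd_of_two_pow_relation (t := t) (t' := t') hA' hA
      (X := q * (β * γ' + γ * β') + (p * q + r) * (γ * γ'))
      (Y := β * β' + p * (β * γ' + γ * β') + (p ^ 2 + q) * (γ * γ'))
      (by linear_combination h1) (by linear_combination h2) hv hw'

lemma exists_pos_pow_relation {G : Type*} [CommGroup G] {u w : G} {l k : ℤ} (hlk : l ≠ 0 ∨ k ≠ 0)
    (h : u ^ l * w ^ k = 1) (hu : ∀ n : ℕ, 0 < n → u ^ n ≠ 1) (hw : ∀ n : ℕ, 0 < n → w ^ n ≠ 1) :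
    ∃ m n : ℕ, 0 < m ∧ 0 < n ∧ (u ^ m = w ^ n ∨ u ^ m * w ^ n = 1) := by
  have zpow_ne {v : G} (hv : ∀ n : ℕ, 0 < n → v ^ n ≠ 1) {z : ℤ} (hz : z ≠ 0) : v ^ z ≠ 1 := by
    intro h0
    apply hv z.natAbs (Int.natAbs_pos.mpr hz)
    rcases Int.natAbs_eq z with h' | h' <;> rw [h'] at h0 <;> simpa using h0
  have hl : l ≠ 0 := by
    rintro rfl
    simp only [zpow_zero, one_mul] at h
    exact zpow_ne hw (by simpa using hlk) h
  have hk : k ≠ 0 := by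
    rintro rfl
    simp only [zpow_zero, mul_one] at h
    exact zpow_ne hu hl h
  refine ⟨l.natAbs, k.natAbs, Int.natAbs_pos.mpr hl, Int.natAbs_pos.mpr hk, ?_⟩
  rcases Int.natAbs_eq l with h1 | h1 <;> rcases Int.natAbs_eq k with h2 | h2 <;>
    rw [h1, h2] at h <;> simp only [zpow_neg, zpow_natCast] at h
  · exact Or.inr h
  · exact Or.inl (mul_inv_eq_one.mp h)
  · exact Or.inl (inv_mul_eq_one.mp h)
  · right
    rw [← mul_inv, inv_eq_one] at h
    exact h

/-- `θ` is a root of `X³ - b X² + c X - d` of degree `3` in a field in which any two units of the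
ring of algebraic integers are multiplicatively dependent. -/
structure IsRankOneRoot {K : Type*} [Field K] (b c d : ℤ) (θ : K) : Prop where
  cube : θ ^ 3 = b * θ ^ 2 - c * θ + d
  indep : ∀ A B C : ℤ, quadComb θ A B C = 0 → A = 0 ∧ B = 0 ∧ C = 0
  dep : ∀ u w : Kˣ, IsIntegral ℤ (u : K) → IsIntegral ℤ ((u⁻¹ : Kˣ) : K) → IsIntegral ℤ (w : K) →
    IsIntegral ℤ ((w⁻¹ : Kˣ) : K) → ∃ l k : ℤ, (l ≠ 0 ∨ k ≠ 0) ∧ u ^ l * w ^ k = 1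

namespace IsRankOneRoot

variable {K : Type*} [Field K] {b c d : ℤ} {θ : K}

lemma isIntegral (h : IsRankOneRoot b c d θ) : IsIntegral ℤ θ := by
  refine ⟨.X ^ 3 - .C b * .X ^ 2 + .C c * .X - .C d, by monicity!, ?_⟩
  simp only [Polynomial.eval₂_add, Polynomial.eval₂_sub, Polynomial.eval₂_mul,
    Polynomial.eval₂_pow, Polynomial.eval₂_X, Polynomial.eval₂_C]
  simp only [algebraMap_int_eq, eq_intCast]
  linear_combination h.cube

lemma isIntegral_unitRatio (h : IsRankOneRoot b c d θ) (P Q : ℤ × ℤ) :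
    IsIntegral ℤ (unitRatio b c d θ P Q) := by
  have hz (n : ℤ) : IsIntegral ℤ (n : K) := isIntegral_algebraMap (R := ℤ) (A := K) (x := n)
  have := h.isIntegral
  exact (hz _).add ((hz _).mul ((((hz _).add ((hz _).mul (hz _))).mul this).sub
    ((hz _).mul (this.pow 2))))

lemma unitRatio_mul_swap (h : IsRankOneRoot b c d θ) {P Q : ℤ × ℤ}
    (hP : monicForm b c d P = 1) (hQ : monicForm b c d Q = 1) :
    unitRatio b c d θ P Q * unitRatio b c d θ Q P = 1 := by
  have hne : (P.1 + P.2 * θ : K) ≠ 0 := by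
    intro h0
    obtain ⟨h1, h2, -⟩ := h.indep P.1 P.2 0 (by simpa [quadComb] using h0)
    simp [monicForm, h1, h2] at hP
  apply mul_left_cancel₀ hne
  rw [← mul_assoc, mul_unitRatio h.cube hP, mul_unitRatio h.cube hQ, mul_one]

lemma exists_pow_relation (h : IsRankOneRoot b c d θ) {P Q P' Q' : ℤ × ℤ}
    (hP : monicForm b c d P = 1) (hQ : monicForm b c d Q = 1)
    (hP' : monicForm b c d P' = 1) (hQ' : monicForm b c d Q' = 1)
    (hPQ : P ≠ Q) (hPQ' : P' ≠ Q') (hc : CongrTwo P Q) (hc' : CongrTwo P' Q') :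
    ∃ m n : ℕ, 0 < m ∧ 0 < n ∧ (unitRatio b c d θ P Q ^ m = unitRatio b c d θ P' Q' ^ n ∨
      unitRatio b c d θ P Q ^ m * unitRatio b c d θ P' Q' ^ n = 1) := by
  have key {P Q : ℤ × ℤ} (hP : monicForm b c d P = 1) (hQ : monicForm b c d Q = 1) (hPQ : P ≠ Q)
      (hc : CongrTwo P Q) : ∃ u : Kˣ, (u : K) = unitRatio b c d θ P Q ∧ IsIntegral ℤ (u : K) ∧
        IsIntegral ℤ ((u⁻¹ : Kˣ) : K) ∧ ∀ n : ℕ, 0 < n → u ^ n ≠ 1 := by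
    refine ⟨⟨unitRatio b c d θ P Q, unitRatio b c d θ Q P, h.unitRatio_mul_swap hP hQ,
      h.unitRatio_mul_swap hQ hP⟩, rfl, h.isIntegral_unitRatio P Q, h.isIntegral_unitRatio Q P,
      fun n hn h1 => ?_⟩
    obtain ⟨σ, D, -, -, hs⟩ := exists_hasSlope_unitRatio h.cube hP hQ hPQ hc
    obtain ⟨k, hk⟩ := hs n hn
    refine hk.ne_one (pointGen_indep h.cube h.indep hP) ?_
    have h2 : unitRatio b c d θ P Q ^ n = 1 := by simpa using congrArg (Units.val) h1
    rw [mul_comm, pow_mul, h2, one_pow]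
  obtain ⟨u, hu, hu1, hu2, hu3⟩ := key hP hQ hPQ hc
  obtain ⟨w, hw, hw1, hw2, hw3⟩ := key hP' hQ' hPQ' hc'
  obtain ⟨l, k, hlk, hrel⟩ := h.dep u w hu1 hu2 hw1 hw2
  obtain ⟨m, n, hm, hn, hmn⟩ := exists_pos_pow_relation hlk hrel hu3 hw3
  refine ⟨m, n, hm, hn, ?_⟩
  rw [← hu, ← hw]
  exact hmn.imp (fun e => by simpa using congrArg Units.val e)
    (fun e => by simpa using congrArg Units.val e)

/-- Determinants of solutions in the same class modulo `2` have the same `2`-adic valuation. -/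
lemma exists_cross_eq (h : IsRankOneRoot b c d θ) {P Q R : ℤ × ℤ}
    (hP : monicForm b c d P = 1) (hQ : monicForm b c d Q = 1) (hR : monicForm b c d R = 1)
    (hPQ : P ≠ Q) (hPR : P ≠ R) (hcQ : CongrTwo P Q) (hcR : CongrTwo P R) :
    ∃ (s : ℕ) (D E : ℤ), Odd D ∧ Odd E ∧ cross P Q = 2 ^ s * D ∧ cross P R = 2 ^ s * E := by
  obtain ⟨σ, D, hD, hσ, hu⟩ := exists_hasSlope_unitRatio h.cube hP hQ hPQ hcQ
  obtain ⟨σ', E, hE, hσ', hw⟩ := exists_hasSlope_unitRatio h.cube hP hR hPR hcR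
  obtain ⟨m, n, hm, hn, hmn⟩ := h.exists_pow_relation hP hQ hP hR hPQ hPR hcQ hcR
  obtain ⟨k, hk⟩ := hu m hm
  obtain ⟨k', hk'⟩ := hw n hn
  have hind := pointGen_indep h.cube h.indep hP
  obtain rfl : σ = σ' := by
    rw [mul_comm, pow_mul] at hk hk'
    rcases hmn with hmn | hmn
    · rw [hmn] at hk
      exact hk.eq_of_eq hind hk'
    · refine hk.eq_of_mul_eq_one (pointGen_cube h.cube P) hind hk' ?_
      rw [← mul_pow, hmn, one_pow]
  exact ⟨σ + 1, D, E, hD, hE, hσ, hσ'⟩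

/-- There are at most two solutions in each class modulo `2`. -/
lemma not_three_congr (h : IsRankOneRoot b c d θ) {P Q R : ℤ × ℤ}
    (hP : monicForm b c d P = 1) (hQ : monicForm b c d Q = 1) (hR : monicForm b c d R = 1)
    (hPQ : P ≠ Q) (hPR : P ≠ R) (hQR : Q ≠ R) (hcQ : CongrTwo P Q) (hcR : CongrTwo P R) :
    False := by
  obtain ⟨s, D, E, hD, hE, hs, hs'⟩ := h.exists_cross_eq hP hQ hR hPQ hPR hcQ hcR
  have hcP : CongrTwo Q P := ⟨hcQ.1.symm, hcQ.2.symm⟩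
  have hcQR : CongrTwo Q R := ⟨hcQ.1.symm.trans hcR.1, hcQ.2.symm.trans hcR.2⟩
  obtain ⟨s', D', E', hD', hE', ht, ht'⟩ := h.exists_cross_eq hQ hP hR hPQ.symm hQR hcP hcQR
  obtain rfl : s = s' := by
    refine two_pow_mul_odd_inj hD hD'.neg ?_
    simp only [cross] at *
    linear_combination -hs - ht
  have plucker (x p q r : ℤ) (hp : Odd p) (hq : Odd q) (hr : Odd r)
      (hx : p * cross Q R - q * cross P R + r * cross P Q = 0) : False := by
    rw [hs, hs', ht'] at hx
    have : p * E' - q * E + r * D = 0 := by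
      apply mul_left_cancel₀ (pow_ne_zero s (two_ne_zero' ℤ))
      linear_combination hx
    have h1 : Odd (p * E' - q * E + r * D) :=
      ((hp.mul hE').sub_odd (hq.mul hE)).add_odd (hr.mul hD)
    rw [this] at h1
    exact absurd h1 (by decide)
  obtain ⟨q1, q2⟩ := hcQ
  obtain ⟨r1, r2⟩ := hcR
  rcases Int.emod_two_eq_zero_or_one P.1 with h1 | h1
  · rcases Int.emod_two_eq_zero_or_one P.2 with h2 | h2
    · have : Odd (monicForm b c d P) := by rw [hP]; exact odd_one
      obtain ⟨i, hi⟩ := Int.even_iff.mpr h1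
      obtain ⟨j, hj⟩ := Int.even_iff.mpr h2
      refine (Int.not_even_iff_odd.mpr this)
        ⟨4 * i ^ 3 + 4 * b * i ^ 2 * j + 4 * c * i * j ^ 2 + 4 * d * j ^ 3, ?_⟩
      rw [monicForm, hi, hj]
      ring
    · exact plucker 0 P.2 Q.2 R.2 (Int.odd_iff.mpr h2) (Int.odd_iff.mpr (q2 ▸ h2))
        (Int.odd_iff.mpr (r2 ▸ h2)) (by simp only [cross]; ring)
  · exact plucker 0 P.1 Q.1 R.1 (Int.odd_iff.mpr h1) (Int.odd_iff.mpr (q1 ▸ h1))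
      (Int.odd_iff.mpr (r1 ▸ h1)) (by simp only [cross]; ring)

/-- The three classes modulo `2` do not all contain two solutions. -/
lemma not_three_pairs (h : IsRankOneRoot b c d θ) {P P' Q Q' R R' : ℤ × ℤ}
    (hP : monicForm b c d P = 1) (hP' : monicForm b c d P' = 1)
    (hQ : monicForm b c d Q = 1) (hQ' : monicForm b c d Q' = 1)
    (hR : monicForm b c d R = 1) (hR' : monicForm b c d R' = 1)
    (hPP : P ≠ P') (hQQ : Q ≠ Q') (hRR : R ≠ R')
    (hcP : CongrTwo P P') (hcQ : CongrTwo Q Q') (hcR : CongrTwo R R')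
    (cP : CongrTwo P (1, 0)) (cQ : CongrTwo Q (0, 1)) (cR : CongrTwo R (1, 1)) : False := by
  have hcube : θ ^ 3 = b * θ ^ 2 + (-c : ℤ) * θ + d := by
    rw [h.cube]; push_cast; ring
  have dir {P P' : ℤ × ℤ} (hP : monicForm b c d P = 1) (hP' : monicForm b c d P' = 1)
      (hPP : P ≠ P') (hcP : CongrTwo P P') (n : ℕ) (hn : 0 < n) :
      HasDirection θ (sqCoeffOne b c d P) (sqCoeffTwo c P) (unitRatio b c d θ P P' ^ (2 * n)) := by
    obtain ⟨σ, D, -, -, hu⟩ := exists_hasSlope_unitRatio h.cube hP hP' hPP hcP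
    obtain ⟨k, hk⟩ := hu n hn
    exact hk.hasDirection h.cube hP
  have pow_rel {u w : K} {m n : ℕ} (hmn : u ^ m = w ^ n ∨ u ^ m * w ^ n = 1) (l : ℕ) :
      u ^ (2 * (m * l)) = w ^ (2 * (n * l)) ∨ u ^ (2 * (m * l)) * w ^ (2 * (n * l)) = 1 := by
    have e (v : K) (m : ℕ) : v ^ (2 * (m * l)) = (v ^ m) ^ (2 * l) := by rw [← pow_mul]; ring_nf
    rw [e, e]
    rcases hmn with hmn | hmn
    · exact Or.inl (by rw [hmn])
    · exact Or.inr (by rw [← mul_pow, hmn, one_pow])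
  obtain ⟨m, n, hm, hn, hmn⟩ := h.exists_pow_relation hP hP' hQ hQ' hPP hQQ hcP hcQ
  obtain ⟨m', n', hm', hn', hmn'⟩ := h.exists_pow_relation hP hP' hR hR' hPP hRR hcP hcR
  obtain ⟨A, β, γ, t, hA, hv, hu⟩ := dir hP hP' hPP hcP (m * m') (Nat.mul_pos hm hm')
  have h2 := HasDirection.transfer hcube h.indep hA hv hu
    (dir hQ hQ' hQQ hcQ (n * m') (Nat.mul_pos hn hm')) (pow_rel hmn m')
  have h3 := HasDirection.transfer hcube h.indep hA hv hu
    (dir hR hR' hRR hcR (n' * m) (Nat.mul_pos hn' hm)) (mul_comm m' m ▸ pow_rel hmn' m)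
  have cast_odd {x : ℤ} (hx : x % 2 = 1) : (x : ZMod 2) = 1 := by
    simpa using (ZMod.intCast_eq_intCast_iff' x 1 2).mpr hx
  have cast_even {x : ℤ} (hx : x % 2 = 0) : (x : ZMod 2) = 0 := by
    simpa using (ZMod.intCast_eq_intCast_iff' x 0 2).mpr hx
  have e1 := cast_odd (Int.odd_iff.mp hv)
  have e2 := cast_odd (Int.odd_iff.mp h2)
  have e3 := cast_odd (Int.odd_iff.mp h3)
  simp only [sqCoeffOne, sqCoeffTwo] at e1 e2 e3
  push_cast at e1 e2 e3
  rw [cast_odd cP.1, cast_even cP.2] at e1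
  rw [cast_even cQ.1, cast_odd cQ.2] at e2
  rw [cast_odd cR.1, cast_odd cR.2] at e3
  generalize (β : ZMod 2) = β at *
  generalize (γ : ZMod 2) = γ at *
  generalize (b : ZMod 2) = b at *
  generalize (c : ZMod 2) = c at *
  generalize (d : ZMod 2) = d at *
  clear * - e1 e2 e3
  revert e1 e2 e3
  revert β γ b c d
  decide

lemma finite_and_ncard_le_five (h : IsRankOneRoot b c d θ) :
    {P : ℤ × ℤ | monicForm b c d P = 1}.Finite ∧ {P : ℤ × ℤ | monicForm b c d P = 1}.ncard ≤ 5 := by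
  let S (v : ℤ × ℤ) : Set (ℤ × ℤ) := {P | monicForm b c d P = 1 ∧ CongrTwo P v}
  have trans {P Q v : ℤ × ℤ} (hP : CongrTwo P v) (hQ : CongrTwo Q v) : CongrTwo P Q :=
    ⟨hP.1.trans hQ.1.symm, hP.2.trans hQ.2.symm⟩
  have no_three (v : ℤ × ℤ) : ∀ P ∈ S v, ∀ Q ∈ S v, ∀ R ∈ S v, P ≠ Q → P ≠ R → Q ≠ R → False :=
    fun P hP Q hQ R hR hPQ hPR hQR =>
      h.not_three_congr hP.1 hQ.1 hR.1 hPQ hPR hQR (trans hP.2 hQ.2) (trans hP.2 hR.2)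
  have hfin (v : ℤ × ℤ) : (S v).Finite := by
    by_contra hinf
    obtain ⟨T, hT, hcard⟩ := Set.Infinite.exists_subset_card_eq hinf 3
    obtain ⟨P, Q, R, hPQ, hPR, hQR, rfl⟩ := Finset.card_eq_three.mp hcard
    exact no_three v P (hT (by simp)) Q (hT (by simp)) R (hT (by simp)) hPQ hPR hQR
  have hle (v : ℤ × ℤ) : (S v).ncard ≤ 2 := by
    by_contra! hlt
    obtain ⟨P, Q, R, hP, hQ, hR, hPQ, hPR, hQR⟩ := (Set.two_lt_ncard_iff (hfin v)).mp hlt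
    exact no_three v P hP Q hQ R hR hPQ hPR hQR
  have hone : (S (1, 0)).ncard ≤ 1 ∨ (S (0, 1)).ncard ≤ 1 ∨ (S (1, 1)).ncard ≤ 1 := by
    by_contra! ⟨h1, h2, h3⟩
    obtain ⟨P, P', hP, hP', hPP⟩ := (Set.one_lt_ncard_iff (hfin _)).mp h1
    obtain ⟨Q, Q', hQ, hQ', hQQ⟩ := (Set.one_lt_ncard_iff (hfin _)).mp h2
    obtain ⟨R, R', hR, hR', hRR⟩ := (Set.one_lt_ncard_iff (hfin _)).mp h3
    exact h.not_three_pairs hP.1 hP'.1 hQ.1 hQ'.1 hR.1 hR'.1 hPP hQQ hRR (trans hP.2 hP'.2)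
      (trans hQ.2 hQ'.2) (trans hR.2 hR'.2) hP.2 hQ.2 hR.2
  have hsub : {P : ℤ × ℤ | monicForm b c d P = 1} ⊆ S (1, 0) ∪ S (0, 1) ∪ S (1, 1) := by
    intro P hP
    have hP1 : monicForm b c d P = 1 := hP
    have hne : ¬ (P.1 % 2 = 0 ∧ P.2 % 2 = 0) := by
      rintro ⟨h1, h2⟩
      obtain ⟨i, hi⟩ := Int.even_iff.mpr h1
      obtain ⟨j, hj⟩ := Int.even_iff.mpr h2
      rw [monicForm, hi, hj] at hP1
      have : 2 * (4 * i ^ 3 + 4 * b * i ^ 2 * j + 4 * c * i * j ^ 2 + 4 * d * j ^ 3) = 1 := by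
        linear_combination hP1
      omega
    simp only [S, CongrTwo, Set.mem_union, Set.mem_ofPred_eq, hP1, true_and]
    omega
  have hfin' := ((hfin (1, 0)).union (hfin (0, 1))).union (hfin (1, 1))
  refine ⟨hfin'.subset hsub, (Set.ncard_le_ncard hsub hfin').trans ?_⟩
  have h1 := Set.ncard_union_le (S (1, 0) ∪ S (0, 1)) (S (1, 1))
  have h2 := Set.ncard_union_le (S (1, 0)) (S (0, 1))
  have := hle (1, 0)
  have := hle (0, 1)
  have := hle (1, 1)
  omega

end IsRankOneRoot

open NumberField in
lemma NumberField.exists_zpow_mul_zpow_eq_one {K : Type*} [Field K] [NumberField K]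
    (hrank : Units.rank K ≤ 1) (u w : (𝓞 K)ˣ) :
    ∃ l k : ℤ, (l ≠ 0 ∨ k ≠ 0) ∧ u ^ l * w ^ k = 1 := by
  have hdep : ¬ LinearIndependent ℤ ![Additive.ofMul u, Additive.ofMul w] := by
    intro hli
    have := hli.fintype_card_le_finrank
    rw [Units.finrank_eq, Fintype.card_fin] at this
    omega
  rw [LinearIndependent.pair_iff] at hdep
  push Not at hdep
  obtain ⟨l, k, h, hlk⟩ := hdep
  refine ⟨l, k, ?_, Additive.ofMul.injective (by simpa using h)⟩
  by_contra! h0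
  exact hlk h0.1 h0.2

open NumberField InfinitePlace in
lemma NumberField.rank_le_one_of_cubic {K : Type*} [Field K] [NumberField K]
    (h3 : Module.finrank ℚ K = 3) {φ : K →+* ℂ} (hφ : ¬ ComplexEmbedding.IsReal φ) :
    Units.rank K ≤ 1 := by
  have hpos : 0 < nrComplexPlaces K := by
    classical
    exact Fintype.card_pos_iff.mpr ⟨⟨InfinitePlace.mk φ, isComplex_mk_iff.mpr hφ⟩⟩
  have h1 := card_add_two_mul_card_eq_rank K
  have h2 := card_eq_nrRealPlaces_add_nrComplexPlaces K
  rw [Units.rank]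
  omega

/-- A rational cubic polynomial of negative discriminant has a nonreal root. -/
lemma Cubic.exists_root_im_ne_zero {P : Cubic ℚ} (ha : P.a ≠ 0) (hd : P.discr < 0) :
    ∃ z : ℂ, P.toPoly.eval₂ (algebraMap ℚ ℂ) z = 0 ∧ z.im ≠ 0 := by
  obtain ⟨x, y, z, hroots⟩ := (Cubic.splits_iff_roots_eq_three (φ := algebraMap ℚ ℂ) ha).mp
    (IsAlgClosed.splits _)
  have isRoot {w : ℂ} (hw : w ∈ ({x, y, z} : Multiset ℂ)) :
      P.toPoly.eval₂ (algebraMap ℚ ℂ) w = 0 := by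
    rw [← hroots, Cubic.map_roots] at hw
    rw [← Polynomial.eval_map]
    exact Polynomial.isRoot_of_mem_roots hw
  by_contra! hreal
  lift x to ℝ using hreal x (isRoot (by simp))
  lift y to ℝ using hreal y (isRoot (by simp))
  lift z to ℝ using hreal z (isRoot (by simp))
  have h := Cubic.discr_eq_prod_three_roots ha hroots
  simp only [eq_ratCast] at h
  have h' : (P.discr : ℝ) = (P.a * P.a * (x - y) * (x - z) * (y - z)) ^ 2 := by exact_mod_cast h
  have h0 : (P.discr : ℝ) < 0 := by exact_mod_cast hd
  have := sq_nonneg (P.a * P.a * (x - y) * (x - z) * (y - z) : ℝ)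
  linarith

/-- The number field generated by a root of an irreducible rational polynomial, embedded in `ℂ`. -/
lemma exists_numberField_root {g : Polynomial ℚ} (hg : Irreducible g) {z : ℂ}
    (hz : g.eval₂ (algebraMap ℚ ℂ) z = 0) :
    ∃ (K : Type) (_ : Field K) (_ : NumberField K) (θ : K) (φ : K →+* ℂ), φ θ = z ∧
      Module.finrank ℚ K = g.natDegree ∧ ∀ p : Polynomial ℚ, Polynomial.aeval θ p = 0 ↔ g ∣ p := by
  have : Fact (Irreducible g) := ⟨hg⟩
  let pb := AdjoinRoot.powerBasis hg.ne_zero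
  have : FiniteDimensional ℚ (AdjoinRoot g) := pb.finite
  refine ⟨AdjoinRoot g, inferInstance, ⟨⟩, AdjoinRoot.root g,
    AdjoinRoot.lift (algebraMap ℚ ℂ) z hz, AdjoinRoot.lift_root hz, ?_, fun p => ?_⟩
  · convert pb.finrank using 1
    exact (AdjoinRoot.powerBasis_dim hg.ne_zero).symm
  · convert AdjoinRoot.mk_eq_zero (f := g) (g := p) using 2
    convert AdjoinRoot.aeval_eq p using 1
    congr!

lemma NumberField.exists_zpow_mul_zpow_eq_one_of_isIntegral {K : Type*} [Field K] [NumberField K]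
    (hrank : Units.rank K ≤ 1) (u w : Kˣ) (hu : IsIntegral ℤ (u : K))
    (hu' : IsIntegral ℤ ((u⁻¹ : Kˣ) : K)) (hw : IsIntegral ℤ (w : K))
    (hw' : IsIntegral ℤ ((w⁻¹ : Kˣ) : K)) : ∃ l k : ℤ, (l ≠ 0 ∨ k ≠ 0) ∧ u ^ l * w ^ k = 1 := by
  have lift {v : Kˣ} (hv : IsIntegral ℤ (v : K)) (hv' : IsIntegral ℤ ((v⁻¹ : Kˣ) : K)) :
      ∃ V : (RingOfIntegers K)ˣ,
        Units.map (algebraMap (RingOfIntegers K) K).toMonoidHom V = v :=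
    ⟨⟨⟨_, hv⟩, ⟨_, hv'⟩, RingOfIntegers.ext v.mul_inv, RingOfIntegers.ext v.inv_mul⟩,
      Units.ext rfl⟩
  obtain ⟨U, rfl⟩ := lift hu hu'
  obtain ⟨W, rfl⟩ := lift hw hw'
  obtain ⟨l, k, hlk, h⟩ := exists_zpow_mul_zpow_eq_one hrank U W
  refine ⟨l, k, hlk, ?_⟩
  rw [← map_zpow, ← map_zpow, ← map_mul, h, map_one]

/-- An integral monic cubic of negative discriminant without rational roots has a root in a field
of unit rank at most `1`. -/
lemma exists_isRankOneRoot {b c d : ℤ} (hroot : ∀ r : ℚ, r ^ 3 - b * r ^ 2 + c * r - d ≠ 0)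
    (hdisc : 18 * b * c * d - 4 * b ^ 3 * d + b ^ 2 * c ^ 2 - 4 * c ^ 3 - 27 * d ^ 2 < 0) :
    ∃ (K : Type) (_ : Field K) (θ : K), IsRankOneRoot b c d θ := by
  let P : Cubic ℚ := ⟨1, -b, c, -d⟩
  have ha : P.a ≠ 0 := one_ne_zero
  have hdeg : P.toPoly.natDegree = 3 := Cubic.natDegree_of_a_ne_zero ha
  have hmonic : P.toPoly.Monic := Cubic.monic_of_a_eq_one rfl
  have hirr : Irreducible P.toPoly := by
    rw [hmonic.irreducible_iff_roots_eq_zero_of_degree_le_three (by omega) (by omega)]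
    refine Multiset.eq_zero_of_forall_notMem fun r hr => hroot r ?_
    have h0 : P.toPoly.eval r = 0 := Polynomial.isRoot_of_mem_roots hr
    simp only [Cubic.toPoly, P, Polynomial.eval_add, Polynomial.eval_mul, Polynomial.eval_pow,
      Polynomial.eval_X, Polynomial.eval_C] at h0
    linear_combination h0
  have hdiscr : P.discr < 0 := by
    have : P.discr =
        ((18 * b * c * d - 4 * b ^ 3 * d + b ^ 2 * c ^ 2 - 4 * c ^ 3 - 27 * d ^ 2 : ℤ) : ℚ) := by
      simp only [Cubic.discr, P]
      push_cast
      ring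
    rw [this]
    exact_mod_cast hdisc
  obtain ⟨z, hz, him⟩ := Cubic.exists_root_im_ne_zero ha hdiscr
  obtain ⟨K, _, _, θ, φ, hφ, h3, hdvd⟩ := exists_numberField_root hirr hz
  have hreal : ¬ NumberField.ComplexEmbedding.IsReal φ := by
    intro h
    have h1 := RingHom.congr_fun h θ
    rw [NumberField.ComplexEmbedding.conjugate_coe_eq, hφ] at h1
    exact him (Complex.conj_eq_iff_im.mp h1)
  have aeval_toPoly (Q : Cubic ℚ) : Polynomial.aeval θ Q.toPoly =
      (Q.a * θ ^ 3 + Q.b * θ ^ 2 + Q.c * θ + Q.d : K) := by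
    simp [Cubic.toPoly]
  refine ⟨K, inferInstance, θ, ?_, ?_,
    NumberField.exists_zpow_mul_zpow_eq_one_of_isIntegral
      (NumberField.rank_le_one_of_cubic (h3.trans hdeg) hreal)⟩
  · have h0 := (hdvd P.toPoly).mpr dvd_rfl
    rw [aeval_toPoly] at h0
    simp only [P] at h0
    push_cast at h0
    linear_combination h0
  · intro A B C h0
    let Q : Cubic ℚ := ⟨0, C, B, A⟩
    have hQ : Polynomial.aeval θ Q.toPoly = 0 := by
      rw [aeval_toPoly, ← h0, quadComb]
      simp only [Q]
      push_cast
      ring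
    have hQ0 := Polynomial.eq_zero_of_dvd_of_natDegree_lt ((hdvd _).mp hQ)
      (hdeg ▸ Nat.lt_succ_of_le (Cubic.natDegree_of_a_eq_zero rfl))
    have hQ1 : Q = 0 := (Cubic.toPoly_eq_zero_iff Q).mp hQ0
    have hA : (A : ℚ) = 0 := congrArg Cubic.d hQ1
    have hB : (B : ℚ) = 0 := congrArg Cubic.c hQ1
    have hC : (C : ℚ) = 0 := congrArg Cubic.b hQ1
    exact ⟨by exact_mod_cast hA, by exact_mod_cast hB, by exact_mod_cast hC⟩

lemma isHomogeneous_quadratic (p q r : ℚ) :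
    (C p * X 0 ^ 2 + C q * X 0 * X 1 + C r * X 1 ^ 2 : MvPolynomial (Fin 2) ℚ).IsHomogeneous 2 := by
  have h0 := isHomogeneous_X ℚ (0 : Fin 2)
  have h1 := isHomogeneous_X ℚ (1 : Fin 2)
  exact ((((isHomogeneous_C _ p).mul (h0.pow 2)).add
    (((isHomogeneous_C _ q).mul h0).mul h1)).add ((isHomogeneous_C _ r).mul (h1.pow 2)))

lemma isHomogeneous_linear (p q : ℚ) :
    (C p * X 0 + C q * X 1 : MvPolynomial (Fin 2) ℚ).IsHomogeneous 1 :=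
  ((isHomogeneous_C _ p).mul (isHomogeneous_X ℚ (0 : Fin 2))).add
    ((isHomogeneous_C _ q).mul (isHomogeneous_X ℚ (1 : Fin 2)))

/-- An irreducible binary cubic form has no nontrivial rational zero. -/
lemma eval_cubicForm_ne_zero {a b c d : ℤ}
    (hirr : ¬ ∃ (G H : MvPolynomial (Fin 2) ℚ) (i j : ℕ),
      G.IsHomogeneous i ∧ H.IsHomogeneous j ∧
      0 < G.totalDegree ∧ 0 < H.totalDegree ∧ cubicForm a b c d = G * H)
    (hne : cubicForm a b c d ≠ 0) {u v : ℚ} (huv : u ≠ 0 ∨ v ≠ 0) :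
    a * u ^ 3 + b * u ^ 2 * v + c * u * v ^ 2 + d * v ^ 3 ≠ 0 := by
  intro h0
  have factor (p q r s t : ℚ)
      (h : cubicForm a b c d =
        (C s * X 0 + C t * X 1) * (C p * X 0 ^ 2 + C q * X 0 * X 1 + C r * X 1 ^ 2)) : False := by
    rw [h] at hne
    refine hirr ⟨_, _, 1, 2, isHomogeneous_linear s t, isHomogeneous_quadratic p q r, ?_, ?_, h⟩
    · rw [(isHomogeneous_linear s t).totalDegree (left_ne_zero_of_mul hne)]; norm_num
    · rw [(isHomogeneous_quadratic p q r).totalDegree (right_ne_zero_of_mul hne)]; norm_num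
  by_cases hv : v = 0
  · subst hv
    have ha : (a : ℚ) = 0 := by simpa [huv.resolve_right] using h0
    refine factor b c d 0 1 ?_
    rw [cubicForm, ha]
    simp only [map_zero, map_one]
    ring
  · obtain ⟨t, rfl⟩ : ∃ t, u = t * v := ⟨u / v, by field_simp⟩
    have hd : (d : ℚ) = -(t * (a * t ^ 2 + b * t + c)) := by
      apply mul_right_cancel₀ (pow_ne_zero 3 hv)
      linear_combination h0
    refine factor a (a * t + b) (a * t ^ 2 + b * t + c) 1 (-t) ?_
    rw [cubicForm, hd]
    simp only [map_add, map_mul, map_neg, map_one, map_pow]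
    ring

lemma cubicForm_ne_zero {a b c d : ℤ}
    (hdisc : 18 * a * b * c * d - 4 * b ^ 3 * d + b ^ 2 * c ^ 2 - 4 * a * c ^ 3
        - 27 * a ^ 2 * d ^ 2 ≠ 0) : cubicForm a b c d ≠ 0 := by
  intro h0
  have ev (x y : ℚ) : a * x ^ 3 + b * x ^ 2 * y + c * x * y ^ 2 + d * y ^ 3 = 0 := by
    simpa [cubicForm] using congrArg (eval ![x, y]) h0
  have ha : (a : ℚ) = 0 := by linear_combination ev 1 0
  have hd : (d : ℚ) = 0 := by linear_combination ev 0 1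
  have hb : (b : ℚ) = 0 := by linear_combination (ev 1 1 - ev 1 (-1)) / 2 - hd + 0 * ha
  simp only [Int.cast_eq_zero] at ha hb hd
  simp [ha, hb, hd] at hdisc

lemma monicForm_finite_and_ncard_le_five {b c d : ℤ}
    (hroot : ∀ r : ℚ, r ^ 3 - b * r ^ 2 + c * r - d ≠ 0)
    (hdisc : 18 * b * c * d - 4 * b ^ 3 * d + b ^ 2 * c ^ 2 - 4 * c ^ 3 - 27 * d ^ 2 < 0) :
    {P : ℤ × ℤ | monicForm b c d P = 1}.Finite ∧ {P : ℤ × ℤ | monicForm b c d P = 1}.ncard ≤ 5 := by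
  obtain ⟨K, _, θ, h⟩ := exists_isRankOneRoot hroot hdisc
  exact h.finite_and_ncard_le_five

/-- **Theorem (Delone, Nagell).** If `F` is an irreducible binary cubic form with integer
coefficients (it does not factor as a product of two nonconstant homogeneous polynomials with
rational coefficients) and negative discriminant, then the number of integer solutions to
`F(m,n) = 1` is at most 5. -/
theorem cubic_thue_at_most_five (a b c d : ℤ)
    (hirr : ¬ ∃ (G H : MvPolynomial (Fin 2) ℚ) (i j : ℕ),
      G.IsHomogeneous i ∧ H.IsHomogeneous j ∧
      0 < G.totalDegree ∧ 0 < H.totalDegree ∧ cubicForm a b c d = G * H)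
    (hdisc : 18 * a * b * c * d - 4 * b ^ 3 * d + b ^ 2 * c ^ 2 - 4 * a * c ^ 3
        - 27 * a ^ 2 * d ^ 2 < 0) :
    {q : ℤ × ℤ | a * q.1 ^ 3 + b * q.1 ^ 2 * q.2 + c * q.1 * q.2 ^ 2 + d * q.2 ^ 3 = 1}.Finite ∧
      {q : ℤ × ℤ |
        a * q.1 ^ 3 + b * q.1 ^ 2 * q.2 + c * q.1 * q.2 ^ 2 + d * q.2 ^ 3 = 1}.ncard ≤ 5 := by
  rcases Set.eq_empty_or_nonempty
    {q : ℤ × ℤ | a * q.1 ^ 3 + b * q.1 ^ 2 * q.2 + c * q.1 * q.2 ^ 2 + d * q.2 ^ 3 = 1} with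
    hS | ⟨⟨m, n⟩, hmn⟩
  · simp [hS]
  have hmn : a * m ^ 3 + b * m ^ 2 * n + c * m * n ^ 2 + d * n ^ 3 = 1 := hmn
  obtain ⟨p, q, hpq⟩ : ∃ p q : ℤ, m * q - n * p = 1 :=
    ⟨-(c * m * n + d * n ^ 2), a * m ^ 2 + b * m * n, by linear_combination hmn⟩
  let b' := 3 * a * m ^ 2 * p + b * (m ^ 2 * q + 2 * m * n * p) + c * (2 * m * n * q + n ^ 2 * p) +
    3 * d * n ^ 2 * q
  let c' := 3 * a * m * p ^ 2 + b * (2 * m * p * q + n * p ^ 2) + c * (m * q ^ 2 + 2 * n * p * q) +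
    3 * d * n * q ^ 2
  let d' := a * p ^ 3 + b * p ^ 2 * q + c * p * q ^ 2 + d * q ^ 3
  have hdisc' : 18 * b' * c' * d' - 4 * b' ^ 3 * d' + b' ^ 2 * c' ^ 2 - 4 * c' ^ 3
      - 27 * d' ^ 2 < 0 := by
    have disc_eq : 18 * (a * m ^ 3 + b * m ^ 2 * n + c * m * n ^ 2 + d * n ^ 3) * b' * c' * d'
        - 4 * b' ^ 3 * d' + b' ^ 2 * c' ^ 2
        - 4 * (a * m ^ 3 + b * m ^ 2 * n + c * m * n ^ 2 + d * n ^ 3) * c' ^ 3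
        - 27 * (a * m ^ 3 + b * m ^ 2 * n + c * m * n ^ 2 + d * n ^ 3) ^ 2 * d' ^ 2 =
        (m * q - n * p) ^ 6 * (18 * a * b * c * d - 4 * b ^ 3 * d + b ^ 2 * c ^ 2 - 4 * a * c ^ 3
          - 27 * a ^ 2 * d ^ 2) := by
      simp only [b', c', d']
      ring
    rw [hmn, hpq] at disc_eq
    linarith
  have hroot (r : ℚ) : r ^ 3 - b' * r ^ 2 + c' * r - d' ≠ 0 := by
    have hpq' : (m * q - n * p : ℚ) = 1 := by exact_mod_cast hpq
    have hmn' : (a * m ^ 3 + b * m ^ 2 * n + c * m * n ^ 2 + d * n ^ 3 : ℚ) = 1 := by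
      exact_mod_cast hmn
    have huv : m * r - p ≠ 0 ∨ n * r - q ≠ 0 := by
      by_contra! ⟨h1, h2⟩
      have : (1 : ℚ) = 0 := by linear_combination -hpq' + n * h1 - m * h2
      exact one_ne_zero this
    intro h0
    refine eval_cubicForm_ne_zero hirr (cubicForm_ne_zero hdisc.ne) huv ?_
    simp only [b', c', d'] at h0
    push_cast at h0
    linear_combination h0 + r ^ 3 * hmn'
  obtain ⟨hfin, hcard⟩ := monicForm_finite_and_ncard_le_five hroot hdisc'
  let f (P : ℤ × ℤ) : ℤ × ℤ := (m * P.1 + p * P.2, n * P.1 + q * P.2)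
  have hsub : {q : ℤ × ℤ |
      a * q.1 ^ 3 + b * q.1 ^ 2 * q.2 + c * q.1 * q.2 ^ 2 + d * q.2 ^ 3 = 1} ⊆
      f '' {P | monicForm b' c' d' P = 1} := by
    rintro ⟨x, y⟩ hxy
    have hxy : a * x ^ 3 + b * x ^ 2 * y + c * x * y ^ 2 + d * y ^ 3 = 1 := hxy
    have hx : m * (q * x - p * y) + p * (m * y - n * x) = x := by linear_combination x * hpq
    have hy : n * (q * x - p * y) + q * (m * y - n * x) = y := by linear_combination y * hpq
    refine ⟨(q * x - p * y, m * y - n * x), ?_, Prod.ext hx hy⟩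
    show monicForm b' c' d' (q * x - p * y, m * y - n * x) = 1
    generalize q * x - p * y = s, m * y - n * x = t at *
    subst hx hy
    simp only [monicForm, b', c', d']
    linear_combination hxy - s ^ 3 * hmn
  exact ⟨(hfin.image f).subset hsub,
    (Set.ncard_le_ncard hsub (hfin.image f)).trans ((Set.ncard_image_le hfin).trans hcard)⟩
end
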